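/- arXiv:1404.0890 — 2 statements merged into one kernel-verified Lean document; each statement's English description precedes it below -/
import Mathlib

section
/- (Interpolation.) Let X_{(n)} be a sequence of Hölder p-rough paths over ℝ^ℓ on [0,T] with the uniform bound sup_n ‖X_{(n)}‖ ≤ C < ∞, and suppose that for each (s,t) with 0≤s≤t≤T and each 1≤i≤⌊p⌋, the tensors X^i_{(n),ts} converge to some X^i_{ts} as n→∞. Then X = (X¹,…,X^{⌊p⌋}) is a Hölder p-rough path with ‖X‖ ≤ C, and for every q with p < q < ⌊p⌋+1 the convergence holds in the Hölder q-rough path distance: max_{1≤i≤⌊p⌋} sup_{0≤s<t≤T} |X^i_{(n),ts} − X^i_{ts}|/|t−s|^{i/q} → 0 as n→∞. -/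
/-!
Statement 10: interpolation for Hölder p-rough paths (proposition on interpolation).

A `k`-tensor over `ℝ^ℓ` is represented by its coordinates on words of length `k` over
the alphabet `Fin ℓ` (tensor product = concatenation of words), with the Euclidean norm.
A Hölder `p`-rough path in two-parameter form is encoded by a single function
`X : ℝ → ℝ → List (Fin ℓ) → ℝ`; its value on words of length `i` is the coordinate
function of the level-`i` component `X^i`, and `X⁰ ≡ 1`.
-/

noncomputable section

/-- Euclidean norm of the level-`i` component of `g : List (Fin ℓ) → ℝ`. -/
def tnorm (ℓ i : ℕ) (g : List (Fin ℓ) → ℝ) : ℝ :=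
  Real.sqrt (∑ v : Fin i → Fin ℓ, g (List.ofFn v) ^ 2)

/-- A Hölder `p`-rough path over `ℝ^ℓ` on `[0,T]`, in two-parameter form, with levels
`1, …, N`. -/
structure HolderRoughPath (ℓ N : ℕ) (T p : ℝ) : Type where
  X : ℝ → ℝ → List (Fin ℓ) → ℝ
  level0 : ∀ s t : ℝ, X t s [] = 1
  chen : ∀ s u t : ℝ, 0 ≤ s → s ≤ u → u ≤ t → t ≤ T → ∀ w : List (Fin ℓ),
    w.length ≤ N →
    X t s w = ∑ i ∈ Finset.range (w.length + 1), X u s (w.take i) * X t u (w.drop i)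
  cont : ∀ w : List (Fin ℓ), w.length ≤ N →
    ContinuousOn (fun q : ℝ × ℝ => X q.2 q.1 w)
      {q : ℝ × ℝ | 0 ≤ q.1 ∧ q.1 ≤ q.2 ∧ q.2 ≤ T}
  holder : ∀ i : ℕ, 1 ≤ i → i ≤ N → ∃ K : ℝ, ∀ s t : ℝ, 0 ≤ s → s < t → t ≤ T →
    tnorm ℓ i (X t s) ≤ K * (t - s) ^ ((i : ℝ) / p)

open Filter Topology Set

section TensorNorm

variable {ℓ i : ℕ}

theorem tnorm_eq_norm (g : List (Fin ℓ) → ℝ) :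
    tnorm ℓ i g =
      ‖(WithLp.toLp 2 fun v => g (List.ofFn v) : EuclideanSpace ℝ (Fin i → Fin ℓ))‖ := by
  simp [tnorm, EuclideanSpace.norm_eq]

theorem tnorm_nonneg (g : List (Fin ℓ) → ℝ) : 0 ≤ tnorm ℓ i g := Real.sqrt_nonneg _

theorem tnorm_sub_le (f g : List (Fin ℓ) → ℝ) :
    tnorm ℓ i (fun w => f w - g w) ≤ tnorm ℓ i f + tnorm ℓ i g := by
  simp only [tnorm_eq_norm]
  exact norm_sub_le (WithLp.toLp 2 fun v => f (List.ofFn v) : EuclideanSpace ℝ (Fin i → Fin ℓ))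
    (WithLp.toLp 2 fun v => g (List.ofFn v))

theorem abs_apply_le_tnorm (g : List (Fin ℓ) → ℝ) (w : List (Fin ℓ)) :
    |g w| ≤ tnorm ℓ w.length g := by
  have h := PiLp.norm_apply_le
    (WithLp.toLp 2 fun v => g (List.ofFn v) : EuclideanSpace ℝ (Fin w.length → Fin ℓ)) w.get
  rw [← tnorm_eq_norm] at h
  simpa using h

theorem tnorm_le_sum_abs (g : List (Fin ℓ) → ℝ) :
    tnorm ℓ i g ≤ ∑ v : Fin i → Fin ℓ, |g (List.ofFn v)| := by
  refine Real.sqrt_le_iff.2 ⟨Finset.sum_nonneg fun _ _ => abs_nonneg _, ?_⟩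
  calc ∑ v : Fin i → Fin ℓ, g (List.ofFn v) ^ 2
      = ∑ v : Fin i → Fin ℓ, |g (List.ofFn v)| ^ 2 := by simp
    _ ≤ (∑ v : Fin i → Fin ℓ, |g (List.ofFn v)|) ^ 2 :=
        Finset.sum_sq_le_sq_sum_of_nonneg fun _ _ => abs_nonneg _

theorem tendsto_tnorm {F : ℕ → List (Fin ℓ) → ℝ} {g : List (Fin ℓ) → ℝ}
    (h : ∀ w : List (Fin ℓ), w.length = i → Tendsto (fun n => F n w) atTop (𝓝 (g w))) :
    Tendsto (fun n => tnorm ℓ i (F n)) atTop (𝓝 (tnorm ℓ i g)) :=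
  (tendsto_finsetSum _ fun v _ => (h (List.ofFn v) (by simp)).pow 2).sqrt

end TensorNorm

/-- The closed simplex of ordered pairs of times in `[0,T]`. -/
def timeSimplex (T : ℝ) : Set (ℝ × ℝ) := {q | 0 ≤ q.1 ∧ q.1 ≤ q.2 ∧ q.2 ≤ T}

theorem isCompact_timeSimplex (T : ℝ) : IsCompact (timeSimplex T) := by
  refine (isCompact_Icc (a := ((0, 0) : ℝ × ℝ)) (b := (T, T))).of_isClosed_subset ?_ ?_
  · exact (isClosed_le continuous_const continuous_fst).inter
      ((isClosed_le continuous_fst continuous_snd).inter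
        (isClosed_le continuous_snd continuous_const))
  · rintro ⟨s, t⟩ ⟨h0, hst, hT⟩
    exact ⟨⟨h0, h0.trans hst⟩, ⟨hst.trans hT, hT⟩⟩

/-- On a compact set, an equicontinuous sequence that converges pointwise converges uniformly. -/
theorem tendstoUniformlyOn_of_uniformEquicontinuous_of_tendsto {α : Type*} [UniformSpace α]
    {K : Set α} (hK : IsCompact K) {F : ℕ → α → ℝ} {f : α → ℝ}
    (hF : UniformEquicontinuous fun n => K.domRestrict (F n))
    (h : ∀ x ∈ K, Tendsto (fun n => F n x) atTop (𝓝 (f x))) :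
    TendstoUniformlyOn F f atTop K := by
  have := isCompact_iff_compactSpace.1 hK
  rw [tendstoUniformlyOn_iff_tendstoUniformly_comp_coe]
  have := (hF.equicontinuous.tendsto_uniformFun_iff_pi atTop (K.domRestrict f)).2
    (tendsto_pi_nhds.2 fun x => h x x.2)
  exact UniformFun.tendsto_iff_tendstoUniformly.1 this

namespace HolderRoughPath

variable {ℓ N : ℕ} {T p : ℝ} (Z : HolderRoughPath ℓ N T p)

theorem apply_self_eq_zero {t : ℝ} (h0 : 0 ≤ t) (hT : t ≤ T) :
    ∀ (k : ℕ) (w : List (Fin ℓ)), w.length = k + 1 → k + 1 ≤ N → Z.X t t w = 0 := by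
  intro k
  induction k using Nat.strong_induction_on with
  | _ k ih =>
    intro w hw hk
    have h := Z.chen t t t h0 le_rfl le_rfl hT w (hw ▸ hk)
    rw [hw, Finset.sum_range_succ, Finset.sum_range_succ', Finset.sum_eq_zero, ← hw] at h
    · simp only [List.take_zero, List.drop_zero, List.take_length, List.drop_length,
        Z.level0] at h
      linarith
    · intro i hi
      have hi := Finset.mem_range.1 hi
      rw [ih i hi (w.take (i + 1)) (by simp; omega) (by omega), zero_mul]

/-- Every positive level of a Hölder `p`-rough path is Hölder continuous with exponent `1/p`. -/
theorem abs_apply_le {C : ℝ} (hp : 0 < p) (hC : 0 ≤ C)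
    (hb : ∀ i : ℕ, 1 ≤ i → i ≤ N → ∀ s t : ℝ, 0 ≤ s → s < t → t ≤ T →
      tnorm ℓ i (Z.X t s) ≤ C * (t - s) ^ ((i : ℝ) / p))
    {s t : ℝ} (h0 : 0 ≤ s) (hst : s ≤ t) (hT : t ≤ T) {w : List (Fin ℓ)}
    (hw : 1 ≤ w.length) (hwN : w.length ≤ N) :
    |Z.X t s w| ≤ C * max 1 T ^ ((N : ℝ) / p) * (t - s) ^ (1 / p) := by
  rcases hst.eq_or_lt with rfl | hlt
  · rw [Z.apply_self_eq_zero h0 hT (w.length - 1) w (by omega) (by omega), abs_zero]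
    positivity
  have hd : 0 < t - s := sub_pos.2 hlt
  have hw' : (1 : ℝ) ≤ w.length := by exact_mod_cast hw
  have hwN' : (w.length : ℝ) ≤ N := by exact_mod_cast hwN
  have hsplit : (t - s) ^ ((w.length : ℝ) / p)
      = (t - s) ^ (((w.length : ℝ) - 1) / p) * (t - s) ^ (1 / p) := by
    rw [← Real.rpow_add hd]; congr 1; ring
  calc |Z.X t s w| ≤ tnorm ℓ w.length (Z.X t s) := abs_apply_le_tnorm _ _
    _ ≤ C * (t - s) ^ ((w.length : ℝ) / p) := hb _ hw hwN s t h0 hlt hT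
    _ = C * (t - s) ^ (((w.length : ℝ) - 1) / p) * (t - s) ^ (1 / p) := by
        rw [hsplit, mul_assoc]
    _ ≤ C * max 1 T ^ ((N : ℝ) / p) * (t - s) ^ (1 / p) := by
        gcongr
        calc (t - s) ^ (((w.length : ℝ) - 1) / p)
            ≤ max 1 T ^ (((w.length : ℝ) - 1) / p) :=
              Real.rpow_le_rpow hd.le ((by linarith : t - s ≤ T).trans (le_max_right _ _))
                (div_nonneg (by linarith) hp.le)
          _ ≤ max 1 T ^ ((N : ℝ) / p) := by
              apply Real.rpow_le_rpow_of_exponent_le (le_max_left _ _)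
              gcongr
              linarith

variable {A : ℝ}

theorem abs_apply_le_const (hp : 0 < p) (hA : 0 ≤ A)
    (hZ : ∀ s t : ℝ, 0 ≤ s → s ≤ t → t ≤ T → ∀ w : List (Fin ℓ), 1 ≤ w.length → w.length ≤ N →
      |Z.X t s w| ≤ A * (t - s) ^ (1 / p))
    {s t : ℝ} (h0 : 0 ≤ s) (hst : s ≤ t) (hT : t ≤ T) {w : List (Fin ℓ)} (hw : w.length ≤ N) :
    |Z.X t s w| ≤ 1 + A * T ^ (1 / p) := by
  have hT0 : 0 ≤ T := h0.trans (hst.trans hT)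
  rcases w.length.eq_zero_or_pos with h | h
  · rw [List.length_eq_zero_iff.1 h, Z.level0, abs_one]
    have : 0 ≤ A * T ^ (1 / p) := by positivity
    linarith
  · have h1 : (t - s) ^ (1 / p) ≤ T ^ (1 / p) :=
      Real.rpow_le_rpow (by linarith) (by linarith) (by positivity)
    have h2 := mul_le_mul_of_nonneg_left h1 hA
    linarith [hZ s t h0 hst hT w h hw]

/-- Chen's relation bounds the increments in the upper time variable. -/
theorem abs_sub_upper_le (hp : 0 < p) (hA : 0 ≤ A)
    (hZ : ∀ s t : ℝ, 0 ≤ s → s ≤ t → t ≤ T → ∀ w : List (Fin ℓ), 1 ≤ w.length → w.length ≤ N →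
      |Z.X t s w| ≤ A * (t - s) ^ (1 / p))
    {s u t : ℝ} (h0 : 0 ≤ s) (hsu : s ≤ u) (hut : u ≤ t) (hT : t ≤ T)
    {w : List (Fin ℓ)} (hw : w.length ≤ N) :
    |Z.X t s w - Z.X u s w| ≤ N * ((1 + A * T ^ (1 / p)) * (A * (t - u) ^ (1 / p))) := by
  have hT0 : 0 ≤ T := by linarith
  have hd : 0 ≤ t - u := sub_nonneg.2 hut
  rw [Z.chen s u t h0 hsu hut hT w hw, Finset.sum_range_succ, List.take_length, List.drop_length,
    Z.level0, mul_one, add_sub_cancel_right]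
  calc |∑ i ∈ Finset.range w.length, Z.X u s (w.take i) * Z.X t u (w.drop i)|
      ≤ ∑ i ∈ Finset.range w.length, (1 + A * T ^ (1 / p)) * (A * (t - u) ^ (1 / p)) := by
        refine (Finset.abs_sum_le_sum_abs _ _).trans (Finset.sum_le_sum fun i hi => ?_)
        have hi := Finset.mem_range.1 hi
        rw [abs_mul]
        exact mul_le_mul
          (Z.abs_apply_le_const hp hA hZ h0 hsu (hut.trans hT) (by simp; omega))
          (hZ u t (h0.trans hsu) hut hT _ (by simp; omega) (by simp; omega))
          (abs_nonneg _) (by positivity)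
    _ ≤ N * ((1 + A * T ^ (1 / p)) * (A * (t - u) ^ (1 / p))) := by
        rw [Finset.sum_const, Finset.card_range, nsmul_eq_mul]
        gcongr

/-- Chen's relation bounds the increments in the lower time variable. -/
theorem abs_sub_lower_le (hp : 0 < p) (hA : 0 ≤ A)
    (hZ : ∀ s t : ℝ, 0 ≤ s → s ≤ t → t ≤ T → ∀ w : List (Fin ℓ), 1 ≤ w.length → w.length ≤ N →
      |Z.X t s w| ≤ A * (t - s) ^ (1 / p))
    {s u t : ℝ} (h0 : 0 ≤ s) (hsu : s ≤ u) (hut : u ≤ t) (hT : t ≤ T)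
    {w : List (Fin ℓ)} (hw : w.length ≤ N) :
    |Z.X t s w - Z.X t u w| ≤ N * ((1 + A * T ^ (1 / p)) * (A * (u - s) ^ (1 / p))) := by
  have hT0 : 0 ≤ T := by linarith
  have hd : 0 ≤ u - s := sub_nonneg.2 hsu
  rw [Z.chen s u t h0 hsu hut hT w hw, Finset.sum_range_succ', List.take_zero, List.drop_zero,
    Z.level0, one_mul, add_sub_cancel_right]
  calc |∑ i ∈ Finset.range w.length, Z.X u s (w.take (i + 1)) * Z.X t u (w.drop (i + 1))|
      ≤ ∑ i ∈ Finset.range w.length, (1 + A * T ^ (1 / p)) * (A * (u - s) ^ (1 / p)) := by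
        refine (Finset.abs_sum_le_sum_abs _ _).trans (Finset.sum_le_sum fun i hi => ?_)
        have hi := Finset.mem_range.1 hi
        rw [abs_mul, mul_comm]
        exact mul_le_mul
          (Z.abs_apply_le_const hp hA hZ (h0.trans hsu) hut hT (by simp; omega))
          (hZ s u h0 hsu (hut.trans hT) _ (by simp; omega) (by simp; omega))
          (abs_nonneg _) (by positivity)
    _ ≤ N * ((1 + A * T ^ (1 / p)) * (A * (u - s) ^ (1 / p))) := by
        rw [Finset.sum_const, Finset.card_range, nsmul_eq_mul]
        gcongr

theorem dist_apply_le (hp : 0 < p) (hA : 0 ≤ A)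
    (hZ : ∀ s t : ℝ, 0 ≤ s → s ≤ t → t ≤ T → ∀ w : List (Fin ℓ), 1 ≤ w.length → w.length ≤ N →
      |Z.X t s w| ≤ A * (t - s) ^ (1 / p))
    {w : List (Fin ℓ)} (hw : w.length ≤ N) {x y : ℝ × ℝ}
    (hx : x ∈ timeSimplex T) (hy : y ∈ timeSimplex T) :
    dist (Z.X x.2 x.1 w) (Z.X y.2 y.1 w)
      ≤ 4 * (N * ((1 + A * T ^ (1 / p)) * (A * dist x y ^ (1 / p)))) := by
  have hT0 : 0 ≤ T := hx.1.trans (hx.2.1.trans hx.2.2)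
  set s₀ := min x.1 y.1 with hs₀
  set t₁ := max x.2 y.2 with ht₁
  have hs0 : 0 ≤ s₀ := le_min hx.1 hy.1
  have ht1 : t₁ ≤ T := max_le hx.2.2 hy.2.2
  have key : ∀ z ∈ timeSimplex T, s₀ ≤ z.1 → z.2 ≤ t₁ → z.1 - s₀ ≤ dist x y →
      t₁ - z.2 ≤ dist x y → |Z.X t₁ s₀ w - Z.X z.2 z.1 w|
        ≤ 2 * (N * ((1 + A * T ^ (1 / p)) * (A * dist x y ^ (1 / p)))) := by
    intro z hz hz1 hz2 hd1 hd2
    have hmono : ∀ d : ℝ, 0 ≤ d → d ≤ dist x y →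
        N * ((1 + A * T ^ (1 / p)) * (A * d ^ (1 / p)))
          ≤ N * ((1 + A * T ^ (1 / p)) * (A * dist x y ^ (1 / p))) := by
      intro d h0 hd
      gcongr
    have h1 := (Z.abs_sub_upper_le hp hA hZ hs0 (hz1.trans hz.2.1) hz2 ht1 hw).trans
      (hmono _ (by linarith) hd2)
    have h2 := (Z.abs_sub_lower_le hp hA hZ hs0 hz1 hz.2.1 hz.2.2 hw).trans
      (hmono _ (by linarith) hd1)
    linarith [abs_sub_le (Z.X t₁ s₀ w) (Z.X z.2 s₀ w) (Z.X z.2 z.1 w)]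
  have hd1 : |x.1 - y.1| ≤ dist x y := le_max_left _ _
  have hd2 : |x.2 - y.2| ≤ dist x y := le_max_right _ _
  have hm1 : x.1 - s₀ ≤ |x.1 - y.1| ∧ y.1 - s₀ ≤ |x.1 - y.1| := by
    rw [hs₀]; constructor <;> grind
  have hm2 : t₁ - x.2 ≤ |x.2 - y.2| ∧ t₁ - y.2 ≤ |x.2 - y.2| := by
    rw [ht₁]; constructor <;> grind
  have hkx := key x hx (min_le_left _ _) (le_max_left _ _) (hm1.1.trans hd1) (hm2.1.trans hd2)
  have hky := key y hy (min_le_right _ _) (le_max_right _ _) (hm1.2.trans hd1) (hm2.2.trans hd2)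
  rw [abs_sub_comm] at hkx
  rw [Real.dist_eq]
  linarith [abs_sub_le (Z.X x.2 x.1 w) (Z.X t₁ s₀ w) (Z.X y.2 y.1 w)]

/-- A bounded sequence of Hölder rough paths is uniformly equicontinuous at each level. -/
theorem uniformEquicontinuous_of_abs_apply_le {Zs : ℕ → HolderRoughPath ℓ N T p}
    (hp : 0 < p) (hA : 0 ≤ A)
    (hZ : ∀ n, ∀ s t : ℝ, 0 ≤ s → s ≤ t → t ≤ T → ∀ w : List (Fin ℓ),
      1 ≤ w.length → w.length ≤ N → |(Zs n).X t s w| ≤ A * (t - s) ^ (1 / p))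
    {w : List (Fin ℓ)} (hw : w.length ≤ N) :
    UniformEquicontinuous fun n =>
      (timeSimplex T).domRestrict fun x : ℝ × ℝ => (Zs n).X x.2 x.1 w := by
  refine Metric.uniformEquicontinuous_of_continuity_modulus
    (fun d => 4 * (N * ((1 + A * T ^ (1 / p)) * (A * d ^ (1 / p))))) ?_ _
    fun x y n => (Zs n).dist_apply_le hp hA (hZ n) hw x.2 y.2
  have hc : Continuous fun d : ℝ => d ^ (1 / p) := Real.continuous_rpow_const (by positivity)
  have := (((hc.tendsto 0).const_mul A).const_mul (1 + A * T ^ (1 / p))).const_mul (N : ℝ)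
    |>.const_mul 4
  rwa [Real.zero_rpow (by positivity), mul_zero, mul_zero, mul_zero, mul_zero] at this

end HolderRoughPath

/-- Geometric interpolation between a uniform bound and a Hölder bound. -/
theorem le_mul_rpow_of_le_of_le_mul_rpow {a η K d p q : ℝ} {i : ℕ} (hp : 0 < p) (hpq : p < q)
    (ha : 0 ≤ a) (hη : a ≤ η) (hd : 0 < d) (hK : 0 ≤ K) (h : a ≤ K * d ^ ((i : ℝ) / p)) :
    a ≤ η ^ (1 - p / q) * K ^ (p / q) * d ^ ((i : ℝ) / q) := by
  have hq : 0 < q := hp.trans hpq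
  have hlt : 0 < 1 - p / q := sub_pos.2 ((div_lt_one hq).2 hpq)
  have hsum : (1 - p / q) + p / q = 1 := by ring
  calc a = a ^ (1 - p / q) * a ^ (p / q) := by
        rw [← Real.rpow_add' ha (by rw [hsum]; exact one_ne_zero), hsum, Real.rpow_one]
    _ ≤ η ^ (1 - p / q) * (K * d ^ ((i : ℝ) / p)) ^ (p / q) := by
        have hη0 : 0 ≤ η := ha.trans hη
        gcongr
    _ = η ^ (1 - p / q) * K ^ (p / q) * d ^ ((i : ℝ) / q) := by
        rw [Real.mul_rpow hK (by positivity), ← Real.rpow_mul hd.le, mul_assoc]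
        congr 3
        field_simp

/-- **Interpolation.**  A sequence of Hölder `p`-rough paths which is bounded in the
Hölder `p`-rough path sense, `sup_n ‖X_{(n)}‖ ≤ C`, and converges pointwise, has a
Hölder `p`-rough path limit `Y` with `‖Y‖ ≤ C`, and converges to `Y` as a Hölder
`q`-rough path for every `p < q < ⌊p⌋ + 1`. -/
theorem roughPath_interpolation
    (ℓ : ℕ) (hℓ : 1 ≤ ℓ) (T p : ℝ) (hT : 0 < T) (hp : 2 ≤ p)
    (Xs : ℕ → HolderRoughPath ℓ ⌊p⌋₊ T p) (C : ℝ) (hC : 0 ≤ C)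
    (hbound : ∀ n : ℕ, ∀ i : ℕ, 1 ≤ i → i ≤ ⌊p⌋₊ → ∀ s t : ℝ, 0 ≤ s → s < t → t ≤ T →
      tnorm ℓ i ((Xs n).X t s) ≤ C * (t - s) ^ ((i : ℝ) / p))
    (hconv : ∀ s t : ℝ, 0 ≤ s → s ≤ t → t ≤ T → ∀ w : List (Fin ℓ),
      1 ≤ w.length → w.length ≤ ⌊p⌋₊ →
      ∃ l : ℝ, Filter.Tendsto (fun n => (Xs n).X t s w) Filter.atTop (nhds l)) :
    ∃ Y : HolderRoughPath ℓ ⌊p⌋₊ T p,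
      (∀ s t : ℝ, 0 ≤ s → s ≤ t → t ≤ T → ∀ w : List (Fin ℓ),
        1 ≤ w.length → w.length ≤ ⌊p⌋₊ →
        Filter.Tendsto (fun n => (Xs n).X t s w) Filter.atTop (nhds (Y.X t s w))) ∧
      (∀ i : ℕ, 1 ≤ i → i ≤ ⌊p⌋₊ → ∀ s t : ℝ, 0 ≤ s → s < t → t ≤ T →
        tnorm ℓ i (Y.X t s) ≤ C * (t - s) ^ ((i : ℝ) / p)) ∧
      (∀ q : ℝ, p < q → q < ⌊p⌋₊ + 1 → ∀ ε > (0:ℝ), ∃ M : ℕ, ∀ n, M ≤ n →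
        ∀ i : ℕ, 1 ≤ i → i ≤ ⌊p⌋₊ → ∀ s t : ℝ, 0 ≤ s → s < t → t ≤ T →
        tnorm ℓ i (fun w => (Xs n).X t s w - Y.X t s w) ≤ ε * (t - s) ^ ((i : ℝ) / q)) := by
  have hp0 : 0 < p := by linarith
  generalize ⌊p⌋₊ = N at *
  set A := C * max 1 T ^ ((N : ℝ) / p)
  have hA : 0 ≤ A := by positivity
  have hZ : ∀ n, ∀ s t : ℝ, 0 ≤ s → s ≤ t → t ≤ T → ∀ w : List (Fin ℓ),
      1 ≤ w.length → w.length ≤ N → |(Xs n).X t s w| ≤ A * (t - s) ^ (1 / p) :=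
    fun n s t h0 hst hT w hw hwN => (Xs n).abs_apply_le hp0 hC (hbound n) h0 hst hT hw hwN
  let Y : ℝ → ℝ → List (Fin ℓ) → ℝ := fun t s w => limUnder atTop fun n => (Xs n).X t s w
  have hY0 : ∀ s t : ℝ, Y t s [] = 1 := fun s t => by
    simp only [Y, HolderRoughPath.level0]
    exact tendsto_const_nhds.limUnder_eq
  have hlim : ∀ s t : ℝ, 0 ≤ s → s ≤ t → t ≤ T → ∀ w : List (Fin ℓ), w.length ≤ N →
      Tendsto (fun n => (Xs n).X t s w) atTop (𝓝 (Y t s w)) := by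
    intro s t h0 hst hT w hw
    rcases w.length.eq_zero_or_pos with h | h
    · rw [List.length_eq_zero_iff.1 h, hY0]
      simp only [HolderRoughPath.level0]
      exact tendsto_const_nhds
    · exact tendsto_nhds_limUnder (hconv s t h0 hst hT w h hw)
  have hunif : ∀ w : List (Fin ℓ), w.length ≤ N →
      TendstoUniformlyOn (fun n (x : ℝ × ℝ) => (Xs n).X x.2 x.1 w)
        (fun x => Y x.2 x.1 w) atTop (timeSimplex T) := fun w hw =>
    tendstoUniformlyOn_of_uniformEquicontinuous_of_tendsto (isCompact_timeSimplex T)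
      (HolderRoughPath.uniformEquicontinuous_of_abs_apply_le hp0 hA hZ hw)
      fun x hx => hlim x.1 x.2 hx.1 hx.2.1 hx.2.2 w hw
  have hYb : ∀ i : ℕ, 1 ≤ i → i ≤ N → ∀ s t : ℝ, 0 ≤ s → s < t → t ≤ T →
      tnorm ℓ i (Y t s) ≤ C * (t - s) ^ ((i : ℝ) / p) := fun i hi hiN s t h0 hst hT =>
    le_of_tendsto (tendsto_tnorm fun w hw => hlim s t h0 hst.le hT w (hw ▸ hiN))
      (Eventually.of_forall fun n => hbound n i hi hiN s t h0 hst hT)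
  refine ⟨⟨Y, hY0, ?_, ?_, fun i hi hiN => ⟨C, hYb i hi hiN⟩⟩,
    fun s t h0 hst hT w _ hw => hlim s t h0 hst hT w hw, hYb, ?_⟩
  · intro s u t h0 hsu hut hT w hw
    refine tendsto_nhds_unique (hlim s t h0 (hsu.trans hut) hT w hw) ?_
    simp only [fun n => (Xs n).chen s u t h0 hsu hut hT w hw]
    refine tendsto_finsetSum _ fun i _ => ?_
    exact (hlim s u h0 hsu (hut.trans hT) _ (by simp; omega)).mul
      (hlim u t (h0.trans hsu) hut hT _ (by simp; omega))
  · exact fun w hw => (hunif w hw).continuousOn (Frequently.of_forall fun n => (Xs n).cont w hw)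
  intro q hpq _ ε hε
  have hq : 0 < q := hp0.trans hpq
  have hlt : 0 < 1 - p / q := sub_pos.2 ((div_lt_one hq).2 hpq)
  obtain ⟨η, hη, hηε⟩ : ∃ η > 0, η ^ (1 - p / q) * (2 * C) ^ (p / q) ≤ ε := by
    have hc : Tendsto (fun η : ℝ => η ^ (1 - p / q) * (2 * C) ^ (p / q)) (𝓝[>] 0) (𝓝 0) := by
      have := (((Real.continuous_rpow_const hlt.le).tendsto 0).mul_const ((2 * C) ^ (p / q)))
      rw [Real.zero_rpow hlt.ne', zero_mul] at this
      exact this.mono_left nhdsWithin_le_nhds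
    obtain ⟨η, h1, h2⟩ := ((hc.eventually_le_const hε).and self_mem_nhdsWithin).exists
    exact ⟨η, h2, h1⟩
  have hsmall : ∀ i ≤ N, ∀ᶠ n in atTop, ∀ s t : ℝ, 0 ≤ s → s < t → t ≤ T →
      tnorm ℓ i (fun w => (Xs n).X t s w - Y t s w) ≤ η := by
    intro i hi
    have hcard : (0 : ℝ) < Fintype.card (Fin i → Fin ℓ) + 1 := by positivity
    have hall : ∀ᶠ n in atTop, ∀ v : Fin i → Fin ℓ, ∀ x ∈ timeSimplex T,
        dist (Y x.2 x.1 (List.ofFn v)) ((Xs n).X x.2 x.1 (List.ofFn v))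
          < η / (Fintype.card (Fin i → Fin ℓ) + 1) :=
      eventually_all.2 fun v =>
        Metric.tendstoUniformlyOn_iff.1 (hunif (List.ofFn v) (by simpa using hi)) _
          (div_pos hη hcard)
    filter_upwards [hall] with n hn s t h0 hst hT
    calc tnorm ℓ i (fun w => (Xs n).X t s w - Y t s w)
        ≤ ∑ v : Fin i → Fin ℓ, |(Xs n).X t s (List.ofFn v) - Y t s (List.ofFn v)| :=
          tnorm_le_sum_abs _
      _ ≤ ∑ v : Fin i → Fin ℓ, η / (Fintype.card (Fin i → Fin ℓ) + 1) := by
          refine Finset.sum_le_sum fun v _ => ?_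
          have := (hn v (s, t) ⟨h0, hst.le, hT⟩).le
          rwa [dist_comm, Real.dist_eq] at this
      _ ≤ η := by
          rw [Finset.sum_const, Finset.card_univ, nsmul_eq_mul, mul_div_assoc', div_le_iff₀ hcard]
          linarith
  obtain ⟨M, hM⟩ := eventually_atTop.1
    ((Set.finite_Iic N).eventually_all.2 hsmall)
  refine ⟨M, fun n hn i hi hiN s t h0 hst hT => ?_⟩
  have hd : 0 < t - s := sub_pos.2 hst
  have hHolder : tnorm ℓ i (fun w => (Xs n).X t s w - Y t s w)
      ≤ 2 * C * (t - s) ^ ((i : ℝ) / p) := by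
    linarith [tnorm_sub_le (i := i) ((Xs n).X t s) (Y t s), hYb i hi hiN s t h0 hst hT,
      hbound n i hi hiN s t h0 hst hT]
  refine (le_mul_rpow_of_le_of_le_mul_rpow hp0 hpq (tnorm_nonneg _)
    (hM n hn i hiN s t h0 hst hT) hd (by positivity) hHolder).trans ?_
  gcongr
end
end

section
/- (Equivalence of the differential and integral formulations of a rough differential equation, 2<p<3.) Let 2<p<3, let (X,𝕏) be a weak geometric Hölder p-rough path over ℝ^ℓ on [0,T], and let V₁,…,V_ℓ be C³_b vector fields on ℝ^d; write F(x)v = v^i V_i(x) for v∈ℝ^ℓ. For a path x : [0,T] → ℝ^d, the following two properties are equivalent. (P1) There exist a>1, δ>0 and c≥0 such that for every bounded C³ function f : ℝ^d → ℝ with bounded derivatives and all s≤t with t−s≤δ: |f(x_t) − f(x_s) − X^i_{ts}(V_if)(x_s) − 𝕏^{jk}_{ts}(V_jV_kf)(x_s)| ≤ c‖f‖_{C³}|t−s|^a. (P2) x is controlled by X with derivative s ↦ F(x_s), and there is a constant c'≥0 such that for all 0≤s≤t≤T: |x_t − x_s − X^i_{ts}V_i(x_s) − 𝕏^{jk}_{ts}(DV_k)(x_s)(V_j(x_s))|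 ≤ c'|t−s|^{3/p}; equivalently, x solves the integral equation x_t = x_0 + ∫₀ᵗ F(x_s) dX_s, where the rough integral of the controlled path s ↦ F(x_s) is the unique additive functional with local expansion F(x_s)X_{ts} + 𝕏^{jk}_{ts}(DV_k)(x_s)(V_j(x_s)) up to O(|t−s|^{3/p}). -/
/-!
Statement 19: equivalence of the differential and integral formulations of a rough
differential equation, 2 < p < 3 (exercise 15).
-/

noncomputable section

variable {d : ℕ}

/-- A function is `C^k_b` if it is `C^k`, bounded, with bounded derivatives up to
order `k`. -/
def CkbMap (k : ℕ) {F : Type*} [NormedAddCommGroup F] [NormedSpace ℝ F]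
    (W : EuclideanSpace ℝ (Fin d) → F) : Prop :=
  ContDiff ℝ k W ∧ ∀ i ≤ k, ∃ M : ℝ, ∀ x, ‖iteratedFDeriv ℝ i W x‖ ≤ M

/-- `‖f‖_{C³}`: the sum of the supremum norms of `f` and its first three derivatives. -/
def C3norm (f : EuclideanSpace ℝ (Fin d) → ℝ) : ℝ :=
  ∑ i ∈ Finset.range 4, ⨆ x, ‖iteratedFDeriv ℝ i f x‖

/-- **(P1)** `x` solves the rough differential equation `dx = F(x) X(dt)` in the
differential (Davie) sense: uniform Taylor–Euler expansion of order `a > 1` tested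
against every `C³_b` function. -/
def SolvesDiff (ℓ : ℕ) (T : ℝ)
    (Vf : Fin ℓ → EuclideanSpace ℝ (Fin d) → EuclideanSpace ℝ (Fin d))
    (X : ℝ → ℝ → EuclideanSpace ℝ (Fin ℓ))
    (XX : ℝ → ℝ → EuclideanSpace ℝ (Fin ℓ × Fin ℓ))
    (x : ℝ → EuclideanSpace ℝ (Fin d)) : Prop :=
  ∃ a > (1:ℝ), ∃ δ > (0:ℝ), ∃ c : ℝ, 0 ≤ c ∧
    ∀ f : EuclideanSpace ℝ (Fin d) → ℝ, CkbMap 3 f →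
    ∀ s t : ℝ, 0 ≤ s → s ≤ t → t ≤ T → t - s ≤ δ →
      |f (x t) - f (x s)
          - (∑ i : Fin ℓ, X t s i * fderiv ℝ f (x s) (Vf i (x s)))
          - ∑ j : Fin ℓ, ∑ k : Fin ℓ, XX t s (j, k) *
              fderiv ℝ (fun y => fderiv ℝ f y (Vf k y)) (x s) (Vf j (x s))| ≤
        c * C3norm f * (t - s) ^ a

/-- **(P2)** `x` is controlled by `X` with derivative `s ↦ F(x_s)`, and solves the
integral equation `x_t = x_0 + ∫₀ᵗ F(x_s) dX_s`, i.e. it has the local expansion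
`x_t - x_s = X^i_{ts} V_i(x_s) + 𝕏^{jk}_{ts} (DV_k)(x_s)(V_j(x_s)) + O(|t-s|^{3/p})`. -/
def SolvesInt (ℓ : ℕ) (T p : ℝ)
    (Vf : Fin ℓ → EuclideanSpace ℝ (Fin d) → EuclideanSpace ℝ (Fin d))
    (X : ℝ → ℝ → EuclideanSpace ℝ (Fin ℓ))
    (XX : ℝ → ℝ → EuclideanSpace ℝ (Fin ℓ × Fin ℓ))
    (x : ℝ → EuclideanSpace ℝ (Fin d)) : Prop :=
  (∃ C : ℝ, ∀ i : Fin ℓ, ∀ s t : ℝ, 0 ≤ s → s ≤ t → t ≤ T →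
    ‖Vf i (x t) - Vf i (x s)‖ ≤ C * (t - s) ^ (1 / p)) ∧
  (∃ C : ℝ, ∀ s t : ℝ, 0 ≤ s → s ≤ t → t ≤ T →
    ‖x t - x s - ∑ i : Fin ℓ, X t s i • Vf i (x s)‖ ≤ C * (t - s) ^ (2 / p)) ∧
  (∃ c' : ℝ, 0 ≤ c' ∧ ∀ s t : ℝ, 0 ≤ s → s ≤ t → t ≤ T →
    ‖x t - x s - (∑ i : Fin ℓ, X t s i • Vf i (x s))
        - ∑ j : Fin ℓ, ∑ k : Fin ℓ, XX t s (j, k) •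
            fderiv ℝ (Vf k) (x s) (Vf j (x s))‖ ≤ c' * (t - s) ^ (3 / p))

section Taylor

variable {E F : Type*} [NormedAddCommGroup E] [NormedSpace ℝ E]
  [NormedAddCommGroup F] [NormedSpace ℝ F]

/-- A differentiable function with `N`-bounded derivative is `N`-Lipschitz. -/
lemma norm_sub_le_of_norm_fderiv_le {g : E → F} (hg : Differentiable ℝ g) {N : ℝ}
    (hN : ∀ x, ‖fderiv ℝ g x‖ ≤ N) (x y : E) : ‖g y - g x‖ ≤ N * ‖y - x‖ :=
  Convex.norm_image_sub_le_of_norm_fderiv_le (s := Set.univ) (fun z _ => hg z)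
    (fun z _ => hN z) convex_univ (Set.mem_univ _) (Set.mem_univ _)

/-- First order Taylor estimate for a function with Lipschitz derivative. -/
lemma norm_taylor_one_le {g : E → F} (hg : Differentiable ℝ g) {N : ℝ} (hN0 : 0 ≤ N)
    (hN : ∀ x y, ‖fderiv ℝ g y - fderiv ℝ g x‖ ≤ N * ‖y - x‖) (x y : E) :
    ‖g y - g x - fderiv ℝ g x (y - x)‖ ≤ N * ‖y - x‖ ^ 2 := by
  have key := Convex.norm_image_sub_le_of_norm_hasFDerivWithin_le (𝕜 := ℝ)
    (f := fun z => g z - g x - fderiv ℝ g x (z - x))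
    (f' := fun z => fderiv ℝ g z - fderiv ℝ g x) (C := N * ‖y - x‖)
    (s := Metric.closedBall x ‖y - x‖) (x := x) (y := y)
    (fun z _ => by
      have h1 := ((hg z).hasFDerivAt.sub_const (g x)).sub
        ((fderiv ℝ g x).hasFDerivAt.comp z ((hasFDerivAt_id z).sub_const x))
      exact h1.hasFDerivWithinAt)
    (fun z hz => (hN x z).trans (by
      have : ‖z - x‖ ≤ ‖y - x‖ := by simpa [dist_eq_norm] using hz
      gcongr))
    (convex_closedBall _ _) (by simp) (by simp [dist_eq_norm])
  simpa [pow_two, mul_assoc] using key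

/-- Second order Taylor estimate for a function with Lipschitz second derivative. -/
lemma norm_taylor_two_le {f : E → F} (hf : ContDiff ℝ 3 f) {N : ℝ} (hN0 : 0 ≤ N)
    (hN : ∀ x y, ‖fderiv ℝ (fderiv ℝ f) y - fderiv ℝ (fderiv ℝ f) x‖ ≤ N * ‖y - x‖) (x y : E) :
    ‖f y - f x - fderiv ℝ f x (y - x)
      - (1 / 2 : ℝ) • fderiv ℝ (fderiv ℝ f) x (y - x) (y - x)‖ ≤ N * ‖y - x‖ ^ 3 := by
  have hfd : Differentiable ℝ f := hf.differentiable (by norm_num)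
  have hf'd : Differentiable ℝ (fderiv ℝ f) :=
    (hf.fderiv_right (m := 2) (by norm_num)).differentiable (by norm_num)
  have hsymm : IsSymmSndFDerivAt ℝ f x :=
    hf.contDiffAt.isSymmSndFDerivAt (by simp; norm_num)
  set H := fderiv ℝ (fderiv ℝ f) x with hH
  have key := Convex.norm_image_sub_le_of_norm_hasFDerivWithin_le (𝕜 := ℝ)
    (f := fun z => f z - f x - fderiv ℝ f x (z - x) - (1 / 2 : ℝ) • H (z - x) (z - x))
    (f' := fun z => fderiv ℝ f z - fderiv ℝ f x - H (z - x)) (C := N * ‖y - x‖ ^ 2)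
    (s := Metric.closedBall x ‖y - x‖) (x := x) (y := y)
    (fun z _ => by
      have h0 := (hasFDerivAt_id (𝕜 := ℝ) z).sub_const x
      have h1 := (((hfd z).hasFDerivAt.sub_const (f x)).sub
        ((fderiv ℝ f x).hasFDerivAt.comp z h0)).sub
        (((H.hasFDerivAt.comp z h0).clm_apply h0).const_smul (1 / 2 : ℝ))
      refine (h1.congr_fderiv ?_).hasFDerivWithinAt
      ext v
      have h2 : H v (z - x) = H (z - x) v := hsymm v (z - x)
      simp only [id, Function.comp, _root_.sub_apply, ContinuousLinearMap.comp_apply,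
        _root_.smul_apply, _root_.add_apply,
        ContinuousLinearMap.flip_apply, ContinuousLinearMap.id_apply, h2]
      module)
    (fun z hz => (norm_taylor_one_le hf'd hN0 hN x z).trans (by
      have : ‖z - x‖ ≤ ‖y - x‖ := by simpa [dist_eq_norm] using hz
      gcongr))
    (convex_closedBall _ _) (by simp) (by simp [dist_eq_norm])
  refine le_of_le_of_eq (by simpa using key) (by ring)

/-- A bound on the second derivative is a Lipschitz bound on the first one. -/
lemma norm_fderiv_sub_le_of_norm_iteratedFDeriv_le {g : E → F} (hg : ContDiff ℝ 2 g) {N : ℝ}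
    (hN : ∀ x, ‖iteratedFDeriv ℝ 2 g x‖ ≤ N) (x y : E) :
    ‖fderiv ℝ g y - fderiv ℝ g x‖ ≤ N * ‖y - x‖ := by
  refine norm_sub_le_of_norm_fderiv_le
    ((hg.fderiv_right (m := 1) (by norm_num)).differentiable (by norm_num)) (fun z => ?_) x y
  rw [← norm_iteratedFDeriv_one, norm_iteratedFDeriv_fderiv]
  exact hN z

end Taylor

/-- The sup norm of each derivative of order at most three is controlled by `C3norm`. -/
lemma CkbMap.norm_iteratedFDeriv_le_C3norm {f : EuclideanSpace ℝ (Fin d) → ℝ} (hf : CkbMap 3 f)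
    {i : ℕ} (hi : i ≤ 3) (x : EuclideanSpace ℝ (Fin d)) :
    ‖iteratedFDeriv ℝ i f x‖ ≤ C3norm f := by
  obtain ⟨M, hM⟩ := hf.2 i hi
  refine (le_ciSup (f := fun x => ‖iteratedFDeriv ℝ i f x‖)
    ⟨M, by rintro _ ⟨y, rfl⟩; exact hM y⟩ x).trans ?_
  exact Finset.single_le_sum (f := fun i => ⨆ x, ‖iteratedFDeriv ℝ i f x‖)
    (fun j _ => Real.iSup_nonneg fun y => norm_nonneg _)
    (Finset.mem_range.2 (by omega))

lemma C3norm_nonneg (f : EuclideanSpace ℝ (Fin d) → ℝ) : 0 ≤ C3norm f :=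
  Finset.sum_nonneg fun _ _ => Real.iSup_nonneg fun _ => norm_nonneg _

/-- A finite family of `C^3_b` maps has common bounds, together with the resulting Lipschitz and
Taylor estimates. -/
lemma exists_common_bound {ℓ : ℕ}
    {V : Fin ℓ → EuclideanSpace ℝ (Fin d) → EuclideanSpace ℝ (Fin d)}
    (hV : ∀ i, CkbMap 3 (V i)) :
    ∃ B : ℝ, 0 ≤ B ∧ ∀ i, (∀ x, ‖V i x‖ ≤ B) ∧ (∀ x, ‖fderiv ℝ (V i) x‖ ≤ B) ∧
      (∀ x y, ‖V i y - V i x‖ ≤ B * ‖y - x‖) ∧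
      (∀ x y, ‖fderiv ℝ (V i) y - fderiv ℝ (V i) x‖ ≤ B * ‖y - x‖) ∧
      (∀ x y, ‖V i y - V i x - fderiv ℝ (V i) x (y - x)‖ ≤ B * ‖y - x‖ ^ 2) := by
  have h : ∀ q : Fin ℓ × Fin 4, ∃ M : ℝ, ∀ x, ‖iteratedFDeriv ℝ (q.2 : ℕ) (V q.1) x‖ ≤ M :=
    fun q => (hV q.1).2 q.2 (by omega)
  choose M hM using h
  obtain ⟨B, hB⟩ := (Set.finite_range M).bddAbove
  have hb : ∀ (i : Fin ℓ) (n : ℕ), n < 4 → ∀ x,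
      ‖iteratedFDeriv ℝ n (V i) x‖ ≤ max B 0 := fun i n hn x =>
    ((hM (i, ⟨n, hn⟩) x).trans (hB ⟨_, rfl⟩)).trans (le_max_left _ _)
  refine ⟨max B 0, le_max_right _ _, fun i => ?_⟩
  have hd : Differentiable ℝ (V i) := (hV i).1.differentiable (by norm_num)
  have h1 : ∀ x, ‖fderiv ℝ (V i) x‖ ≤ max B 0 := fun x => by
    simpa only [norm_iteratedFDeriv_one] using hb i 1 (by norm_num) x
  have h3 := norm_fderiv_sub_le_of_norm_iteratedFDeriv_le ((hV i).1.of_le (by norm_num))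
    (hb i 2 (by norm_num))
  exact ⟨fun x => by simpa only [norm_iteratedFDeriv_zero] using hb i 0 (by norm_num) x, h1,
    norm_sub_le_of_norm_fderiv_le hd h1, h3, norm_taylor_one_le hd (le_max_right _ _) h3⟩

/-- Compactly supported smooth functions are `C^3_b`, and translating them does not change the
bounds. -/
lemma exists_C3norm_translate_le {g : EuclideanSpace ℝ (Fin d) → ℝ} (hg : ContDiff ℝ 3 g)
    (hc : HasCompactSupport g) :
    ∃ N : ℝ, 0 ≤ N ∧ ∀ v, CkbMap 3 (fun y => g (y - v)) ∧ C3norm (fun y => g (y - v)) ≤ N := by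
  have h : ∀ i : ℕ, i ≤ 3 → ∃ M : ℝ, ∀ x, ‖iteratedFDeriv ℝ i g x‖ ≤ M := fun i hi =>
    (hg.continuous_iteratedFDeriv (by exact_mod_cast hi)).bounded_above_of_compact_support
      (hc.iteratedFDeriv i)
  refine ⟨C3norm g, C3norm_nonneg g, fun v => ⟨⟨?_, fun i hi => ?_⟩, ?_⟩⟩
  · exact hg.comp (contDiff_id.sub contDiff_const)
  · obtain ⟨M, hM⟩ := h i hi
    exact ⟨M, fun x => by rw [iteratedFDeriv_comp_sub]; exact hM _⟩
  · unfold C3norm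
    refine Finset.sum_le_sum fun i hi => ciSup_le fun x => ?_
    rw [iteratedFDeriv_comp_sub]
    obtain ⟨M, hM⟩ := h i (by have := Finset.mem_range.1 hi; omega)
    exact le_ciSup (f := fun x => ‖iteratedFDeriv ℝ i g x‖)
      ⟨M, by rintro _ ⟨y, rfl⟩; exact hM y⟩ (x - v)

/-- If an almost additive two-parameter family is `O((t-s)^a)` with `a > 1` and its additivity
defect is `O((t-s)^θ)` with `θ > 1`, then the family is `O((t-s)^θ)`. -/
lemma norm_le_of_almost_additive {E : Type*} [SeminormedAddCommGroup E] {Z : ℝ → ℝ → E}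
    {T δ a θ c C : ℝ} (ha : 1 < a) (hθ : 1 < θ) (hC : 0 ≤ C)
    (hZ : ∀ s t, 0 ≤ s → s ≤ t → t ≤ T → t - s ≤ δ → ‖Z s t‖ ≤ c * (t - s) ^ a)
    (hdef : ∀ s u t, 0 ≤ s → s ≤ u → u ≤ t → t ≤ T → t - s ≤ δ →
      ‖Z s t - Z u t - Z s u‖ ≤ C * (t - s) ^ θ) :
    ∃ C' : ℝ, 0 ≤ C' ∧ ∀ s t, 0 ≤ s → s ≤ t → t ≤ T → t - s ≤ δ →
      ‖Z s t‖ ≤ C' * (t - s) ^ θ := by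
  have hq : (2 : ℝ) * (1 / 2) ^ θ < 1 := by
    have : ((1 : ℝ) / 2) ^ θ < (1 / 2) ^ (1 : ℝ) :=
      Real.rpow_lt_rpow_of_exponent_gt (by norm_num) (by norm_num) hθ
    rw [Real.rpow_one] at this
    linarith
  have hqa : (2 : ℝ) * (1 / 2) ^ a < 1 := by
    have : ((1 : ℝ) / 2) ^ a < (1 / 2) ^ (1 : ℝ) :=
      Real.rpow_lt_rpow_of_exponent_gt (by norm_num) (by norm_num) ha
    rw [Real.rpow_one] at this
    linarith
  set q : ℝ := 2 * (1 / 2) ^ θ with hqdef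
  set r : ℝ := 2 * (1 / 2) ^ a with hrdef
  have hr0 : 0 ≤ r := by positivity
  set C' : ℝ := C / (1 - q) with hC'
  have hC'0 : 0 ≤ C' := div_nonneg hC (by linarith)
  have hfix : q * C' + C = C' := by
    have : 1 - q ≠ 0 := by linarith
    rw [hC']; field_simp; ring
  refine ⟨C', hC'0, fun s t h0 hst htT hδ => ?_⟩
  have key : ∀ n : ℕ, ∀ s t, 0 ≤ s → s ≤ t → t ≤ T → t - s ≤ δ →
      ‖Z s t‖ ≤ r ^ n * (c * (t - s) ^ a) + C' * (t - s) ^ θ := by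
    intro n
    induction n with
    | zero =>
      intro s t h0 hst htT hδ
      have := hZ s t h0 hst htT hδ
      have h2 : 0 ≤ C' * (t - s) ^ θ := mul_nonneg hC'0 (Real.rpow_nonneg (by linarith) _)
      simpa using this.trans (le_add_of_nonneg_right h2)
    | succ n ih =>
      intro s t h0 hst htT hδ
      have e1 : t - (s + t) / 2 = (t - s) * (1 / 2) := by ring
      have e2 : (s + t) / 2 - s = (t - s) * (1 / 2) := by ring
      have b1 := ih ((s + t) / 2) t (by linarith) (by linarith) htT (by linarith)
      have b2 := ih s ((s + t) / 2) h0 (by linarith) (by linarith) (by linarith)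
      have b3 := hdef s ((s + t) / 2) t h0 (by linarith) (by linarith) htT hδ
      rw [e1, Real.mul_rpow (by linarith) (by norm_num),
        Real.mul_rpow (by linarith) (by norm_num)] at b1
      rw [e2, Real.mul_rpow (by linarith) (by norm_num),
        Real.mul_rpow (by linarith) (by norm_num)] at b2
      have b4 : ‖Z s t‖ ≤ ‖Z s t - Z ((s + t) / 2) t - Z s ((s + t) / 2)‖
          + ‖Z ((s + t) / 2) t‖ + ‖Z s ((s + t) / 2)‖ := by
        have := norm_add₃_le (a := Z s t - Z ((s + t) / 2) t - Z s ((s + t) / 2))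
          (b := Z ((s + t) / 2) t) (c := Z s ((s + t) / 2))
        rwa [show Z s t - Z ((s + t) / 2) t - Z s ((s + t) / 2) + Z ((s + t) / 2) t
          + Z s ((s + t) / 2) = Z s t by abel] at this
      calc ‖Z s t‖ ≤ r ^ (n + 1) * (c * (t - s) ^ a) + (q * C' + C) * (t - s) ^ θ := by
            rw [pow_succ, hrdef, hqdef]
            nlinarith [b1, b2, b3, b4]
        _ = _ := by rw [hfix]
  have hlim : Filter.Tendsto (fun n : ℕ => r ^ n * (c * (t - s) ^ a) + C' * (t - s) ^ θ)
      Filter.atTop (nhds (0 * (c * (t - s) ^ a) + C' * (t - s) ^ θ)) :=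
    ((tendsto_pow_atTop_nhds_zero_of_lt_one hr0 hqa).mul_const _).add_const _
  have := ge_of_tendsto' hlim fun n => key n s t h0 hst htT hδ
  simpa using this

/-- A path with increments bounded at small scale has bounded increments. -/
lemma exists_norm_sub_le_of_local {E : Type*} [SeminormedAddCommGroup E] {x : ℝ → E}
    {T δ M : ℝ} (hδ : 0 < δ) (hM : 0 ≤ M)
    (h : ∀ s t, 0 ≤ s → s ≤ t → t ≤ T → t - s ≤ δ → ‖x t - x s‖ ≤ M) :
    ∃ M' : ℝ, 0 ≤ M' ∧ ∀ s t, 0 ≤ s → s ≤ t → t ≤ T → ‖x t - x s‖ ≤ M' := by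
  have key : ∀ n : ℕ, ∀ s t, 0 ≤ s → s ≤ t → t ≤ T → t - s ≤ n * δ →
      ‖x t - x s‖ ≤ (n + 1) * M := by
    intro n
    induction n with
    | zero =>
      intro s t h0 hst htT hn
      simpa using h s t h0 hst htT (hn.trans (by simpa using hδ.le))
    | succ n ih =>
      intro s t h0 hst htT hn
      push_cast at hn ⊢
      rcases le_total (t - s) δ with h1 | h1
      · have := h s t h0 hst htT h1
        have : 0 ≤ (n : ℝ) * M := by positivity
        linarith
      · have b1 := ih s (t - δ) h0 (by linarith) (by linarith) (by linarith)
        have b2 := h (t - δ) t (by linarith) (by linarith) htT (by linarith)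
        have b3 := norm_add_le (x t - x (t - δ)) (x (t - δ) - x s)
        rw [sub_add_sub_cancel] at b3
        linarith
  obtain ⟨n, hn⟩ := exists_nat_ge (T / δ)
  refine ⟨(n + 1) * M, by positivity, fun s t h0 hst htT => key n s t h0 hst htT ?_⟩
  rw [div_le_iff₀ hδ] at hn
  linarith

/-- A bounded quantity that is `O((t-s)^α)` at small scale is `O((t-s)^α)` at every scale. -/
lemma exists_le_rpow_of_local {G : ℝ → ℝ → ℝ} {T δ K M α : ℝ} (hδ : 0 < δ)
    (hα : 0 ≤ α) (hM : ∀ s t, 0 ≤ s → s ≤ t → t ≤ T → G s t ≤ M)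
    (hK : ∀ s t, 0 ≤ s → s ≤ t → t ≤ T → t - s ≤ δ → G s t ≤ K * (t - s) ^ α) :
    ∃ C : ℝ, 0 ≤ C ∧ ∀ s t, 0 ≤ s → s ≤ t → t ≤ T → G s t ≤ C * (t - s) ^ α := by
  refine ⟨max (max K (M / δ ^ α)) 0, le_max_right _ _, fun s t h0 hst htT => ?_⟩
  have hpos : 0 ≤ (t - s) ^ α := Real.rpow_nonneg (by linarith) _
  rcases le_total (t - s) δ with h1 | h1
  · refine (hK s t h0 hst htT h1).trans ?_
    gcongr
    exact (le_max_left _ _).trans (le_max_left _ _)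
  · have hδα : 0 < δ ^ α := Real.rpow_pos_of_pos hδ _
    calc G s t ≤ M := hM s t h0 hst htT
      _ = M / δ ^ α * δ ^ α := by field_simp
      _ ≤ max (max K (M / δ ^ α)) 0 * δ ^ α := by
        gcongr
        exact (le_max_right _ _).trans (le_max_left _ _)
      _ ≤ _ := by gcongr

section Euler

variable {ℓ : ℕ} (V : Fin ℓ → EuclideanSpace ℝ (Fin d) → EuclideanSpace ℝ (Fin d))

/-- First order part of the Euler scheme. -/
def eulerOne (v : EuclideanSpace ℝ (Fin ℓ)) (y : EuclideanSpace ℝ (Fin d)) :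
    EuclideanSpace ℝ (Fin d) :=
  ∑ i : Fin ℓ, v i • V i y

/-- Second order part of the Euler scheme. -/
def eulerTwo (w : EuclideanSpace ℝ (Fin ℓ × Fin ℓ)) (y : EuclideanSpace ℝ (Fin d)) :
    EuclideanSpace ℝ (Fin d) :=
  ∑ j : Fin ℓ, ∑ k : Fin ℓ, w (j, k) • fderiv ℝ (V k) y (V j y)

variable {V}

lemma norm_eulerOne_le {B : ℝ} (hB : ∀ i x, ‖V i x‖ ≤ B)
    (v : EuclideanSpace ℝ (Fin ℓ)) (y : EuclideanSpace ℝ (Fin d)) :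
    ‖eulerOne V v y‖ ≤ ℓ * (‖v‖ * B) := by
  have h : ∀ i ∈ (Finset.univ : Finset (Fin ℓ)), ‖v i • V i y‖ ≤ ‖v‖ * B := by
    intro i _
    rw [norm_smul]
    gcongr
    · exact PiLp.norm_apply_le v i
    · exact hB i y
  simpa [eulerOne] using norm_sum_le_of_le _ h

lemma norm_sum_sum_smul_le {w : EuclideanSpace ℝ (Fin ℓ × Fin ℓ)}
    {U : Fin ℓ → Fin ℓ → EuclideanSpace ℝ (Fin d)} {M : ℝ} (hU : ∀ j k, ‖U j k‖ ≤ M) :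
    ‖∑ j : Fin ℓ, ∑ k : Fin ℓ, w (j, k) • U j k‖ ≤ ℓ * (ℓ * (‖w‖ * M)) := by
  have h : ∀ j ∈ (Finset.univ : Finset (Fin ℓ)),
      ‖∑ k : Fin ℓ, w (j, k) • U j k‖ ≤ ℓ * (‖w‖ * M) := by
    intro j _
    have h' : ∀ k ∈ (Finset.univ : Finset (Fin ℓ)), ‖w (j, k) • U j k‖ ≤ ‖w‖ * M := by
      intro k _
      rw [norm_smul]
      gcongr
      · exact PiLp.norm_apply_le w (j, k)
      · exact hU j k
    simpa using norm_sum_le_of_le _ h'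
  simpa using norm_sum_le_of_le _ h

lemma norm_eulerTwo_le {B : ℝ} (hB0 : 0 ≤ B) (hB : ∀ i x, ‖V i x‖ ≤ B)
    (hB' : ∀ i x, ‖fderiv ℝ (V i) x‖ ≤ B)
    (w : EuclideanSpace ℝ (Fin ℓ × Fin ℓ)) (y : EuclideanSpace ℝ (Fin d)) :
    ‖eulerTwo V w y‖ ≤ ℓ * (ℓ * (‖w‖ * (B * B))) :=
  norm_sum_sum_smul_le fun j k => (ContinuousLinearMap.le_opNorm _ _).trans (by
    gcongr
    exacts [hB' k y, hB j y])

lemma sum_mul_fderiv (f : EuclideanSpace ℝ (Fin d) → ℝ)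
    (v : EuclideanSpace ℝ (Fin ℓ)) (y : EuclideanSpace ℝ (Fin d)) :
    ∑ i : Fin ℓ, v i * fderiv ℝ f y (V i y) = fderiv ℝ f y (eulerOne V v y) := by
  simp [eulerOne]

lemma fderiv_fderiv_apply {f : EuclideanSpace ℝ (Fin d) → ℝ} (hf : ContDiff ℝ 3 f)
    {U : EuclideanSpace ℝ (Fin d) → EuclideanSpace ℝ (Fin d)} (hU : Differentiable ℝ U)
    (y u : EuclideanSpace ℝ (Fin d)) :
    fderiv ℝ (fun y => fderiv ℝ f y (U y)) y u =
      fderiv ℝ f y (fderiv ℝ U y u) + fderiv ℝ (fderiv ℝ f) y u (U y) := by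
  have hf'd : Differentiable ℝ (fderiv ℝ f) :=
    (hf.fderiv_right (m := 2) (by norm_num)).differentiable (by norm_num)
  rw [((hf'd y).hasFDerivAt.clm_apply (hU y).hasFDerivAt).fderiv]
  simp

/-- For a weak geometric second level, the symmetry of the Hessian turns the iterated
derivatives into a quadratic form in the first order Euler increment. -/
lemma sum_sum_mul_fderiv_fderiv {f : EuclideanSpace ℝ (Fin d) → ℝ} (hf : ContDiff ℝ 3 f)
    (hV : ∀ i, Differentiable ℝ (V i)) {v : EuclideanSpace ℝ (Fin ℓ)}
    {w : EuclideanSpace ℝ (Fin ℓ × Fin ℓ)} (hw : ∀ j k, w (j, k) + w (k, j) = v j * v k)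
    (y : EuclideanSpace ℝ (Fin d)) :
    ∑ j : Fin ℓ, ∑ k : Fin ℓ, w (j, k) *
        fderiv ℝ (fun y => fderiv ℝ f y (V k y)) y (V j y) =
      fderiv ℝ f y (eulerTwo V w y)
        + 1 / 2 * fderiv ℝ (fderiv ℝ f) y (eulerOne V v y) (eulerOne V v y) := by
  have hsymm : IsSymmSndFDerivAt ℝ f y :=
    hf.contDiffAt.isSymmSndFDerivAt (by simp; norm_num)
  set H := fderiv ℝ (fderiv ℝ f) y with hH
  have h1 : ∑ j : Fin ℓ, ∑ k : Fin ℓ, w (j, k) * H (V j y) (V k y)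
      = ∑ j : Fin ℓ, ∑ k : Fin ℓ, w (k, j) * H (V j y) (V k y) := by
    rw [Finset.sum_comm]
    refine Finset.sum_congr rfl fun j _ => Finset.sum_congr rfl fun k _ => ?_
    rw [hsymm (V k y) (V j y)]
  have h2 : H (eulerOne V v y) (eulerOne V v y)
      = ∑ j : Fin ℓ, ∑ k : Fin ℓ, v j * v k * H (V j y) (V k y) := by
    simp only [eulerOne, map_sum, map_smul, _root_.sum_apply, _root_.smul_apply, smul_eq_mul,
      Finset.mul_sum]
    rw [Finset.sum_comm]
    exact Finset.sum_congr rfl fun j _ => Finset.sum_congr rfl fun k _ => by ring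
  have h3 : H (eulerOne V v y) (eulerOne V v y)
      = 2 * ∑ j : Fin ℓ, ∑ k : Fin ℓ, w (j, k) * H (V j y) (V k y) := by
    rw [two_mul]
    nth_rewrite 2 [h1]
    simp only [h2, ← Finset.sum_add_distrib, ← add_mul, hw]
  rw [h3]
  simp only [fderiv_fderiv_apply hf (hV _), mul_add, Finset.sum_add_distrib, eulerTwo, map_sum,
    map_smul, smul_eq_mul, ← hH]
  ring

/-- Davie's expansion of a test function along a single Euler step. -/
lemma abs_davie_le {f : EuclideanSpace ℝ (Fin d) → ℝ} (hf : CkbMap 3 f)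
    (hV : ∀ i, Differentiable ℝ (V i)) {v : EuclideanSpace ℝ (Fin ℓ)}
    {w : EuclideanSpace ℝ (Fin ℓ × Fin ℓ)} (hw : ∀ j k, w (j, k) + w (k, j) = v j * v k)
    (y z : EuclideanSpace ℝ (Fin d)) :
    |f z - f y - (∑ i : Fin ℓ, v i * fderiv ℝ f y (V i y))
        - ∑ j : Fin ℓ, ∑ k : Fin ℓ, w (j, k) *
            fderiv ℝ (fun y => fderiv ℝ f y (V k y)) y (V j y)| ≤
      C3norm f * (‖z - y‖ ^ 3 + ‖z - y - eulerOne V v y - eulerTwo V w y‖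
        + ‖z - y - eulerOne V v y‖ * (‖z - y‖ + ‖eulerOne V v y‖)) := by
  have hN := C3norm_nonneg f
  have hf1 : ‖fderiv ℝ f y‖ ≤ C3norm f := by
    rw [← norm_iteratedFDeriv_one]
    exact hf.norm_iteratedFDeriv_le_C3norm (by norm_num) y
  have hf2 : ‖fderiv ℝ (fderiv ℝ f) y‖ ≤ C3norm f := by
    rw [← norm_iteratedFDeriv_one, norm_iteratedFDeriv_fderiv]
    exact hf.norm_iteratedFDeriv_le_C3norm (by norm_num) y
  have hf3 := norm_fderiv_sub_le_of_norm_iteratedFDeriv_le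
    (hf.1.fderiv_right (m := 2) (by norm_num)) (N := C3norm f) fun u => by
      rw [norm_iteratedFDeriv_fderiv]
      exact hf.norm_iteratedFDeriv_le_C3norm (by norm_num) u
  have hT := norm_taylor_two_le hf.1 hN hf3 y z
  rw [sum_mul_fderiv, sum_sum_mul_fderiv_fderiv hf.1 hV hw]
  set H := fderiv ℝ (fderiv ℝ f) y with hH
  set h := z - y with hh
  set D1 := eulerOne V v y
  set D2 := eulerTwo V w y
  have e : f z - f y - fderiv ℝ f y D1 - (fderiv ℝ f y D2 + 1 / 2 * H D1 D1)
      = (f z - f y - fderiv ℝ f y h - (1 / 2 : ℝ) • H h h) + fderiv ℝ f y (h - D1 - D2)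
        + 1 / 2 * (H (h - D1) h + H D1 (h - D1)) := by
    simp only [map_sub, _root_.sub_apply, smul_eq_mul]
    ring
  have b1 := ((fderiv ℝ f y).le_opNorm (h - D1 - D2)).trans
    (mul_le_mul_of_nonneg_right hf1 (norm_nonneg _))
  have b2 : ‖H (h - D1) h‖ ≤ C3norm f * ‖h - D1‖ * ‖h‖ :=
    (H.le_opNorm₂ _ _).trans (by gcongr)
  have b3 : ‖H D1 (h - D1)‖ ≤ C3norm f * ‖D1‖ * ‖h - D1‖ :=
    (H.le_opNorm₂ _ _).trans (by gcongr)
  rw [e, ← Real.norm_eq_abs]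
  refine (norm_add₃_le).trans ?_
  have b4 : ‖1 / 2 * (H (h - D1) h + H D1 (h - D1))‖
      ≤ ‖H (h - D1) h‖ + ‖H D1 (h - D1)‖ := by
    rw [norm_mul, Real.norm_of_nonneg (by norm_num : (0 : ℝ) ≤ 1 / 2)]
    have := norm_add_le (H (h - D1) h) (H D1 (h - D1))
    have := norm_nonneg (H (h - D1) h + H D1 (h - D1))
    linarith
  linarith

/-- The additivity defect of the Euler remainder over two consecutive steps. -/
lemma norm_euler_defect_le {B : ℝ} (hB0 : 0 ≤ B) (hB : ∀ i x, ‖V i x‖ ≤ B)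
    (hB' : ∀ i x, ‖fderiv ℝ (V i) x‖ ≤ B)
    (hlip : ∀ i x y, ‖V i y - V i x‖ ≤ B * ‖y - x‖)
    (hlip' : ∀ i x y, ‖fderiv ℝ (V i) y - fderiv ℝ (V i) x‖ ≤ B * ‖y - x‖)
    (htay : ∀ i x y, ‖V i y - V i x - fderiv ℝ (V i) x (y - x)‖ ≤ B * ‖y - x‖ ^ 2)
    {v v₁ v₂ : EuclideanSpace ℝ (Fin ℓ)} {w w₁ w₂ : EuclideanSpace ℝ (Fin ℓ × Fin ℓ)}
    (hv : v = v₂ + v₁) (hw : ∀ q, w q = w₂ q + w₁ q + v₁ q.1 * v₂ q.2)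
    (x y z : EuclideanSpace ℝ (Fin d)) :
    ‖(z - x - eulerOne V v x - eulerTwo V w x)
        - (z - y - eulerOne V v₂ y - eulerTwo V w₂ y)
        - (y - x - eulerOne V v₁ x - eulerTwo V w₁ x)‖ ≤
      ℓ * (‖v₂‖ * (B * ‖y - x‖ ^ 2 + B * ‖y - x - eulerOne V v₁ x‖))
        + ℓ * (ℓ * (‖w₂‖ * (2 * (B * B) * ‖y - x‖))) := by
  have e : (z - x - eulerOne V v x - eulerTwo V w x)
        - (z - y - eulerOne V v₂ y - eulerTwo V w₂ y)
        - (y - x - eulerOne V v₁ x - eulerTwo V w₁ x)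
      = (∑ k : Fin ℓ, v₂ k • ((V k y - V k x - fderiv ℝ (V k) x (y - x))
            + fderiv ℝ (V k) x (y - x - eulerOne V v₁ x)))
        + ∑ j : Fin ℓ, ∑ k : Fin ℓ, w₂ (j, k) •
            (fderiv ℝ (V k) y (V j y) - fderiv ℝ (V k) x (V j x)) := by
    have hc : ∑ j : Fin ℓ, ∑ k : Fin ℓ, (v₁ j * v₂ k) • fderiv ℝ (V k) x (V j x)
        = ∑ k : Fin ℓ, v₂ k • fderiv ℝ (V k) x (eulerOne V v₁ x) := by
      rw [Finset.sum_comm]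
      refine Finset.sum_congr rfl fun k _ => ?_
      simp only [eulerOne, map_sum, map_smul, Finset.smul_sum, smul_smul]
      exact Finset.sum_congr rfl fun j _ => by rw [mul_comm]
    have h1 : eulerOne V v x = eulerOne V v₂ x + eulerOne V v₁ x := by
      simp [eulerOne, hv, add_smul, Finset.sum_add_distrib]
    have h2 : eulerTwo V w x = eulerTwo V w₂ x + eulerTwo V w₁ x
        + ∑ k : Fin ℓ, v₂ k • fderiv ℝ (V k) x (eulerOne V v₁ x) := by
      simp only [← hc, eulerTwo, hw, add_smul, Finset.sum_add_distrib]
    have h3 : (∑ k : Fin ℓ, v₂ k • ((V k y - V k x - fderiv ℝ (V k) x (y - x))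
            + fderiv ℝ (V k) x (y - x - eulerOne V v₁ x)))
        = eulerOne V v₂ y - eulerOne V v₂ x
          - ∑ k : Fin ℓ, v₂ k • fderiv ℝ (V k) x (eulerOne V v₁ x) := by
      change _ = (∑ k : Fin ℓ, v₂ k • V k y) - (∑ k : Fin ℓ, v₂ k • V k x) - _
      simp only [← Finset.sum_sub_distrib, ← smul_sub]
      refine Finset.sum_congr rfl fun k _ => ?_
      rw [map_sub (fderiv ℝ (V k) x) (y - x)]
      congr 1
      abel
    have h4 : (∑ j : Fin ℓ, ∑ k : Fin ℓ, w₂ (j, k) •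
            (fderiv ℝ (V k) y (V j y) - fderiv ℝ (V k) x (V j x)))
        = eulerTwo V w₂ y - eulerTwo V w₂ x := by
      simp only [eulerTwo, smul_sub, Finset.sum_sub_distrib]
    rw [h1, h2, h3, h4]
    abel
  rw [e]
  refine (norm_add_le _ _).trans (add_le_add ?_ (norm_sum_sum_smul_le fun j k => ?_))
  · have h : ∀ k ∈ (Finset.univ : Finset (Fin ℓ)),
        ‖v₂ k • ((V k y - V k x - fderiv ℝ (V k) x (y - x))
            + fderiv ℝ (V k) x (y - x - eulerOne V v₁ x))‖
          ≤ ‖v₂‖ * (B * ‖y - x‖ ^ 2 + B * ‖y - x - eulerOne V v₁ x‖) := by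
      intro k _
      rw [norm_smul]
      gcongr
      · exact PiLp.norm_apply_le v₂ k
      · refine (norm_add_le _ _).trans (add_le_add (htay k x y) ?_)
        exact ((fderiv ℝ (V k) x).le_opNorm _).trans (by gcongr; exact hB' k x)
    simpa using norm_sum_le_of_le _ h
  · have e' : fderiv ℝ (V k) y (V j y) - fderiv ℝ (V k) x (V j x)
        = (fderiv ℝ (V k) y - fderiv ℝ (V k) x) (V j y)
          + fderiv ℝ (V k) x (V j y - V j x) := by
      simp
    have b1 : ‖(fderiv ℝ (V k) y - fderiv ℝ (V k) x) (V j y)‖ ≤ B * ‖y - x‖ * B :=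
      (ContinuousLinearMap.le_opNorm _ _).trans (by
        gcongr
        exacts [hlip' k x y, hB j y])
    have b2 : ‖fderiv ℝ (V k) x (V j y - V j x)‖ ≤ B * (B * ‖y - x‖) :=
      (ContinuousLinearMap.le_opNorm _ _).trans (by
        gcongr
        exacts [hB' k x, hlip j x y])
    rw [e']
    refine (norm_add_le _ _).trans ?_
    linarith

end Euler

/-- A test function which is affine near the base point only sees the Euler step. -/
lemma davie_of_eventuallyEq_affine {ℓ : ℕ}
    {V : Fin ℓ → EuclideanSpace ℝ (Fin d) → EuclideanSpace ℝ (Fin d)}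
    (hV : ∀ i, Differentiable ℝ (V i)) {f : EuclideanSpace ℝ (Fin d) → ℝ}
    {y : EuclideanSpace ℝ (Fin d)} {b : ℝ} {L : EuclideanSpace ℝ (Fin d) →L[ℝ] ℝ}
    (hf : f =ᶠ[nhds y] fun u => b + L (u - y))
    (v : EuclideanSpace ℝ (Fin ℓ)) (w : EuclideanSpace ℝ (Fin ℓ × Fin ℓ))
    (z : EuclideanSpace ℝ (Fin d)) :
    f z - f y - (∑ i : Fin ℓ, v i * fderiv ℝ f y (V i y))
        - ∑ j : Fin ℓ, ∑ k : Fin ℓ, w (j, k) *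
            fderiv ℝ (fun y => fderiv ℝ f y (V k y)) y (V j y) =
      f z - b - L (eulerOne V v y + eulerTwo V w y) := by
  have hfy : f y = b := by simpa using hf.self_of_nhds
  have hL : ∀ u, fderiv ℝ (fun u => b + L (u - y)) u = L := fun u =>
    ((L.hasFDerivAt.comp u ((hasFDerivAt_id u).sub_const y)).const_add b).fderiv
  have hf' : fderiv ℝ f =ᶠ[nhds y] fun _ => L :=
    hf.fderiv.trans (Filter.Eventually.of_forall hL)
  have hf'' : ∀ j k, fderiv ℝ (fun y => fderiv ℝ f y (V k y)) y (V j y)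
      = L (fderiv ℝ (V k) y (V j y)) := by
    intro j k
    have h1 : (fun y => fderiv ℝ f y (V k y)) =ᶠ[nhds y] fun u => L (V k u) :=
      hf'.mono fun u hu => by simp only [hu]
    have h2 : HasFDerivAt (fun u => L (V k u)) (L ∘L fderiv ℝ (V k) y) y :=
      L.hasFDerivAt.comp y (hV k y).hasFDerivAt
    rw [h1.fderiv_eq, h2.fderiv]
    rfl
  simp only [hf'', hf'.self_of_nhds, hfy, eulerOne, eulerTwo, map_add, map_sum, map_smul,
    smul_eq_mul]
  ring

lemma EuclideanSpace.norm_le_sum_norm {ι : Type*} [Fintype ι] (x : EuclideanSpace ℝ ι) :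
    ‖x‖ ≤ ∑ i, ‖x i‖ := by
  conv_lhs => rw [← (EuclideanSpace.basisFun ι ℝ).sum_repr x]
  refine (norm_sum_le _ _).trans_eq (Finset.sum_congr rfl fun i _ => ?_)
  simp [norm_smul]

/-- The differential formulation, tested against localized coordinate functions, controls the
Euler remainder of the path itself. -/
lemma SolvesDiff.exists_norm_euler_le {ℓ : ℕ} {T : ℝ}
    {V : Fin ℓ → EuclideanSpace ℝ (Fin d) → EuclideanSpace ℝ (Fin d)}
    {X : ℝ → ℝ → EuclideanSpace ℝ (Fin ℓ)} {XX : ℝ → ℝ → EuclideanSpace ℝ (Fin ℓ × Fin ℓ)}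
    {x : ℝ → EuclideanSpace ℝ (Fin d)} (hV : ∀ i, Differentiable ℝ (V i))
    (h : SolvesDiff ℓ T V X XX x) :
    ∃ a > (1 : ℝ), ∃ δ > (0 : ℝ), δ ≤ 1 ∧ ∃ c : ℝ, 0 ≤ c ∧ ∀ s t, 0 ≤ s → s ≤ t → t ≤ T →
      t - s ≤ δ → ‖x t - x s - eulerOne V (X t s) (x s) - eulerTwo V (XX t s) (x s)‖
        ≤ c * (t - s) ^ a := by
  obtain ⟨a, ha, δ, hδ, c, hc, h⟩ := h
  have affine : ∀ (g : EuclideanSpace ℝ (Fin d) → ℝ) (b : ℝ)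
      (L : EuclideanSpace ℝ (Fin d) →L[ℝ] ℝ), ContDiff ℝ 3 g → HasCompactSupport g →
      (g =ᶠ[nhds 0] fun u => b + L u) → ∃ N : ℝ, 0 ≤ N ∧ ∀ s t, 0 ≤ s → s ≤ t → t ≤ T →
        t - s ≤ δ → |g (x t - x s) - b
          - L (eulerOne V (X t s) (x s) + eulerTwo V (XX t s) (x s))| ≤ N * (t - s) ^ a := by
    intro g b L hg hgc hgL
    obtain ⟨N, hN0, hN⟩ := exists_C3norm_translate_le hg hgc
    refine ⟨c * N, mul_nonneg hc hN0, fun s t h0 hst htT hδ' => ?_⟩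
    have h1 := h _ (hN (x s)).1 s t h0 hst htT hδ'
    have h2 : (fun u => g (u - x s)) =ᶠ[nhds (x s)] fun u => b + L (u - x s) := by
      have : Filter.Tendsto (fun u => u - x s) (nhds (x s)) (nhds 0) := by
        have : Continuous fun u => u - x s := by fun_prop
        simpa using this.tendsto (x s)
      exact this.eventually hgL
    rw [davie_of_eventuallyEq_affine hV h2] at h1
    refine h1.trans ?_
    have : 0 ≤ (t - s) ^ a := Real.rpow_nonneg (by linarith) _
    gcongr
    exact (hN (x s)).2
  let χ₁ : ContDiffBump (0 : EuclideanSpace ℝ (Fin d)) := ⟨1 / 2, 1, by norm_num, by norm_num⟩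
  let χ₂ : ContDiffBump (0 : EuclideanSpace ℝ (Fin d)) := ⟨1, 2, by norm_num, by norm_num⟩
  obtain ⟨N, hN0, hN⟩ := affine χ₁ 1 0 χ₁.contDiff χ₁.hasCompactSupport
    (χ₁.eventuallyEq_one.trans (Filter.Eventually.of_forall fun u => by simp))
  have hcoord : ∀ i : Fin d, ∃ M : ℝ, 0 ≤ M ∧ ∀ s t, 0 ≤ s → s ≤ t → t ≤ T →
      t - s ≤ δ → |(x t - x s) i * χ₂ (x t - x s) - 0
        - EuclideanSpace.proj i (eulerOne V (X t s) (x s) + eulerTwo V (XX t s) (x s))|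
          ≤ M * (t - s) ^ a := by
    intro i
    refine affine (fun u => u i * χ₂ u) 0 (EuclideanSpace.proj i) ?_ ?_ ?_
    · exact (EuclideanSpace.proj i : EuclideanSpace ℝ (Fin d) →L[ℝ] ℝ).contDiff.mul χ₂.contDiff
    · exact χ₂.hasCompactSupport.mul_left
    · filter_upwards [χ₂.eventuallyEq_one] with u hu
      simp [hu]
  choose M hM0 hM using hcoord
  refine ⟨a, ha, min (min δ 1) (1 / (N + 1)), by positivity,
    (min_le_left _ _).trans (min_le_right _ _), ∑ i, M i, Finset.sum_nonneg fun i _ => hM0 i,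
    fun s t h0 hst htT hts => ?_⟩
  have hts1 : t - s ≤ δ := hts.trans ((min_le_left _ _).trans (min_le_left _ _))
  have hts2 : t - s ≤ 1 := hts.trans ((min_le_left _ _).trans (min_le_right _ _))
  have hts3 : t - s ≤ 1 / (N + 1) := hts.trans (min_le_right _ _)
  have hball : x t - x s ∈ Metric.ball (0 : EuclideanSpace ℝ (Fin d)) 1 := by
    rw [← show Function.support χ₁ = Metric.ball _ 1 from χ₁.support_eq]
    intro h0'
    have h1 := hN s t h0 hst htT hts1
    have h2 : (t - s) ^ a ≤ t - s := by
      simpa using Real.rpow_le_rpow_of_exponent_ge' (by linarith) hts2 zero_le_one ha.le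
    have h3 : N * (t - s) ^ a ≤ N * (1 / (N + 1)) := by gcongr; linarith
    have h4 : N * (1 / (N + 1)) < 1 := by
      rw [mul_one_div, div_lt_one (by linarith)]
      linarith
    rw [h0'] at h1
    norm_num at h1
    linarith
  have hone : χ₂ (x t - x s) = 1 :=
    χ₂.one_of_mem_closedBall (Metric.ball_subset_closedBall hball)
  refine (EuclideanSpace.norm_le_sum_norm _).trans ?_
  rw [Finset.sum_mul]
  refine Finset.sum_le_sum fun i _ => le_of_eq_of_le ?_ (hM i s t h0 hst htT hts1)
  rw [hone, Real.norm_eq_abs]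
  congr 1
  simp
  ring

/-- The integral formulation implies the differential one. -/
lemma SolvesInt.solvesDiff {ℓ : ℕ} {T p : ℝ} (hp1 : 2 < p) (hp2 : p < 3)
    {V : Fin ℓ → EuclideanSpace ℝ (Fin d) → EuclideanSpace ℝ (Fin d)}
    (hV : ∀ i, CkbMap 3 (V i))
    {X : ℝ → ℝ → EuclideanSpace ℝ (Fin ℓ)} {XX : ℝ → ℝ → EuclideanSpace ℝ (Fin ℓ × Fin ℓ)}
    (hgeom : ∀ s t : ℝ, 0 ≤ s → s ≤ t → t ≤ T → ∀ j k : Fin ℓ,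
      XX t s (j, k) + XX t s (k, j) = X t s j * X t s k)
    {K : ℝ} (hX : ∀ s t : ℝ, 0 ≤ s → s ≤ t → t ≤ T → ‖X t s‖ ≤ K * (t - s) ^ (1 / p))
    {x : ℝ → EuclideanSpace ℝ (Fin d)} (h : SolvesInt ℓ T p V X XX x) :
    SolvesDiff ℓ T V X XX x := by
  obtain ⟨-, ⟨C, hC⟩, c', hc', hZ⟩ := h
  obtain ⟨B, hB0, hB⟩ := exists_common_bound hV
  set C₀ := max C 0
  set K₀ := max K 0
  have hC₀ : 0 ≤ C₀ := le_max_right _ _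
  have hK₀ : 0 ≤ K₀ := le_max_right _ _
  refine ⟨3 / p, by rw [gt_iff_lt, lt_div_iff₀ (by linarith)]; linarith, 1, one_pos,
    (ℓ * (K₀ * B) + C₀) ^ 3 + c' + C₀ * ((ℓ * (K₀ * B) + C₀) + ℓ * (K₀ * B)), by positivity,
    fun f hf s t h0 hst htT hts => ?_⟩
  set σ := (t - s) ^ (1 / p) with hσ
  have hts0 : 0 ≤ t - s := by linarith
  have hσ0 : 0 ≤ σ := Real.rpow_nonneg hts0 _
  have hσ1 : σ ≤ 1 := Real.rpow_le_one hts0 hts (by positivity)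
  have e2 : (t - s) ^ (2 / p) = σ ^ 2 := by
    rw [hσ, ← Real.rpow_natCast, ← Real.rpow_mul hts0]; congr 1; push_cast; ring
  have e3 : (t - s) ^ (3 / p) = σ ^ 3 := by
    rw [hσ, ← Real.rpow_natCast, ← Real.rpow_mul hts0]; congr 1; push_cast; ring
  have b1 : ‖eulerOne V (X t s) (x s)‖ ≤ ℓ * (K₀ * B) * σ := by
    refine (norm_eulerOne_le (fun i => (hB i).1) _ _).trans ?_
    have : ‖X t s‖ ≤ K₀ * σ := (hX s t h0 hst htT).trans (by gcongr; exact le_max_left _ _)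
    calc (ℓ : ℝ) * (‖X t s‖ * B) ≤ ℓ * (K₀ * σ * B) := by gcongr
      _ = _ := by ring
  have b2 : ‖x t - x s - eulerOne V (X t s) (x s)‖ ≤ C₀ * σ ^ 2 := by
    refine (hC s t h0 hst htT).trans ?_
    rw [e2]
    gcongr
    exact le_max_left _ _
  have b3 : ‖x t - x s - eulerOne V (X t s) (x s) - eulerTwo V (XX t s) (x s)‖ ≤ c' * σ ^ 3 := by
    rw [← e3]
    exact hZ s t h0 hst htT
  have b4 : ‖x t - x s‖ ≤ (ℓ * (K₀ * B) + C₀) * σ := by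
    have h1 := norm_add_le (x t - x s - eulerOne V (X t s) (x s)) (eulerOne V (X t s) (x s))
    rw [sub_add_cancel] at h1
    have h2 : C₀ * σ ^ 2 ≤ C₀ * σ := by gcongr; nlinarith
    linarith
  have hd : ∀ i, Differentiable ℝ (V i) := fun i => (hV i).1.differentiable (by norm_num)
  refine (abs_davie_le hf hd (hgeom s t h0 hst htT) _ _).trans ?_
  rw [e3]
  have hN := C3norm_nonneg f
  calc _ ≤ C3norm f * (((ℓ * (K₀ * B) + C₀) * σ) ^ 3 + c' * σ ^ 3
        + C₀ * σ ^ 2 * ((ℓ * (K₀ * B) + C₀) * σ + ℓ * (K₀ * B) * σ)) := by gcongr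
    _ = _ := by ring

/-- The differential formulation implies the integral one. -/
lemma SolvesDiff.solvesInt {ℓ : ℕ} {T p : ℝ} (hp1 : 2 < p) (hp2 : p < 3)
    {V : Fin ℓ → EuclideanSpace ℝ (Fin d) → EuclideanSpace ℝ (Fin d)}
    (hV : ∀ i, CkbMap 3 (V i))
    {X : ℝ → ℝ → EuclideanSpace ℝ (Fin ℓ)} {XX : ℝ → ℝ → EuclideanSpace ℝ (Fin ℓ × Fin ℓ)}
    (hChen : ∀ s u t : ℝ, 0 ≤ s → s ≤ u → u ≤ t → t ≤ T →
      X t s = X t u + X u s ∧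
      ∀ q : Fin ℓ × Fin ℓ, XX t s q = XX t u q + XX u s q + X u s q.1 * X t u q.2)
    {K : ℝ} (hhol : ∀ s t : ℝ, 0 ≤ s → s ≤ t → t ≤ T →
      ‖X t s‖ ≤ K * (t - s) ^ (1 / p) ∧ ‖XX t s‖ ≤ K * (t - s) ^ (2 / p))
    {x : ℝ → EuclideanSpace ℝ (Fin d)} (h : SolvesDiff ℓ T V X XX x) :
    SolvesInt ℓ T p V X XX x := by
  have hd : ∀ i, Differentiable ℝ (V i) := fun i => (hV i).1.differentiable (by norm_num)
  obtain ⟨a, ha, δ, hδ, hδ1, c, hc, hZ⟩ := h.exists_norm_euler_le hd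
  obtain ⟨B, hB0, hB⟩ := exists_common_bound hV
  set K₀ := max K 0
  have hK₀ : 0 ≤ K₀ := le_max_right _ _
  have hp0 : 0 < p := by linarith
  have hX : ∀ s t, 0 ≤ s → s ≤ t → t ≤ T → ‖X t s‖ ≤ K₀ * (t - s) ^ (1 / p) :=
    fun s t h0 hst htT => (hhol s t h0 hst htT).1.trans (by
      have := Real.rpow_nonneg (sub_nonneg.2 hst) (1 / p)
      gcongr
      exact le_max_left _ _)
  have e2 : ∀ τ : ℝ, 0 ≤ τ → τ ^ (2 / p) = (τ ^ (1 / p)) ^ 2 := fun τ hτ => by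
    rw [← Real.rpow_natCast, ← Real.rpow_mul hτ]; congr 1; push_cast; ring
  have e3 : ∀ τ : ℝ, 0 ≤ τ → τ ^ (3 / p) = (τ ^ (1 / p)) ^ 3 := fun τ hτ => by
    rw [← Real.rpow_natCast, ← Real.rpow_mul hτ]; congr 1; push_cast; ring
  have hXX : ∀ s t, 0 ≤ s → s ≤ t → t ≤ T → ‖XX t s‖ ≤ K₀ * ((t - s) ^ (1 / p)) ^ 2 :=
    fun s t h0 hst htT => (hhol s t h0 hst htT).2.trans (by
      rw [e2 _ (sub_nonneg.2 hst)]
      gcongr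
      exact le_max_left _ _)
  have hE1 : ∀ s t, 0 ≤ s → s ≤ t → t ≤ T →
      ‖eulerOne V (X t s) (x s)‖ ≤ ℓ * (K₀ * B) * (t - s) ^ (1 / p) := by
    intro s t h0 hst htT
    refine (norm_eulerOne_le (fun i => (hB i).1) _ _).trans ?_
    calc (ℓ : ℝ) * (‖X t s‖ * B) ≤ ℓ * (K₀ * (t - s) ^ (1 / p) * B) := by
          gcongr; exact hX s t h0 hst htT
      _ = _ := by ring
  have hE2 : ∀ s t, 0 ≤ s → s ≤ t → t ≤ T →
      ‖eulerTwo V (XX t s) (x s)‖ ≤ ℓ * (ℓ * (K₀ * (B * B))) * ((t - s) ^ (1 / p)) ^ 2 := by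
    intro s t h0 hst htT
    refine (norm_eulerTwo_le hB0 (fun i => (hB i).1) (fun i => (hB i).2.1) _ _).trans ?_
    calc (ℓ : ℝ) * (ℓ * (‖XX t s‖ * (B * B)))
        ≤ ℓ * (ℓ * (K₀ * ((t - s) ^ (1 / p)) ^ 2 * (B * B))) := by
          gcongr; exact hXX s t h0 hst htT
      _ = _ := by ring
  set A₁ : ℝ := ℓ * (K₀ * B) with hA₁
  set A₂ : ℝ := ℓ * (ℓ * (K₀ * (B * B))) with hA₂
  have hA₁0 : 0 ≤ A₁ := by positivity
  have hA₂0 : 0 ≤ A₂ := by positivity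
  have hcont : ∀ s t, 0 ≤ s → s ≤ t → t ≤ T → t - s ≤ δ →
      ‖x t - x s - eulerOne V (X t s) (x s)‖ ≤ (c + A₂) * ((t - s) ^ (1 / p)) ^ 2 := by
    intro s t h0 hst htT hts
    have h1 := norm_add_le (x t - x s - eulerOne V (X t s) (x s) - eulerTwo V (XX t s) (x s))
      (eulerTwo V (XX t s) (x s))
    rw [sub_add_cancel] at h1
    have h2 : (t - s) ^ a ≤ ((t - s) ^ (1 / p)) ^ 2 := by
      rw [← e2 _ (sub_nonneg.2 hst)]
      refine Real.rpow_le_rpow_of_exponent_ge' (sub_nonneg.2 hst) (hts.trans hδ1)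
        (by positivity) ?_
      rw [div_le_iff₀ hp0]
      nlinarith
    have h3 : c * (t - s) ^ a ≤ c * ((t - s) ^ (1 / p)) ^ 2 := by gcongr
    linarith [hZ s t h0 hst htT hts, hE2 s t h0 hst htT]
  set A : ℝ := A₁ + (c + A₂) with hA
  have hA0 : 0 ≤ A := by positivity
  have hinc : ∀ s t, 0 ≤ s → s ≤ t → t ≤ T → t - s ≤ δ →
      ‖x t - x s‖ ≤ A * (t - s) ^ (1 / p) := by
    intro s t h0 hst htT hts
    have h1 := norm_add_le (x t - x s - eulerOne V (X t s) (x s)) (eulerOne V (X t s) (x s))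
    rw [sub_add_cancel] at h1
    have hσ0 := Real.rpow_nonneg (sub_nonneg.2 hst) (1 / p)
    have hσ1 : (t - s) ^ (1 / p) ≤ 1 :=
      Real.rpow_le_one (sub_nonneg.2 hst) (hts.trans hδ1) (by positivity)
    have h2 : (c + A₂) * ((t - s) ^ (1 / p)) ^ 2 ≤ (c + A₂) * (t - s) ^ (1 / p) := by
      gcongr; nlinarith
    rw [hA]
    linarith [hcont s t h0 hst htT hts, hE1 s t h0 hst htT]
  obtain ⟨C', hC'0, hC'⟩ := norm_le_of_almost_additive (θ := 3 / p)
    (C := ℓ * (K₀ * (B * A ^ 2 + B * (c + A₂))) + ℓ * (ℓ * (K₀ * (2 * (B * B) * A))))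
    (Z := fun s t => x t - x s - eulerOne V (X t s) (x s) - eulerTwo V (XX t s) (x s)) ha
    (by rw [lt_div_iff₀ hp0]; linarith) (by positivity) hZ (by
      intro s u t h0 hsu hut htT hts
      refine (norm_euler_defect_le hB0 (fun i => (hB i).1) (fun i => (hB i).2.1)
        (fun i => (hB i).2.2.1) (fun i => (hB i).2.2.2.1) (fun i => (hB i).2.2.2.2)
        (hChen s u t h0 hsu hut htT).1 (hChen s u t h0 hsu hut htT).2 _ _ _).trans ?_
      rw [e3 _ (by linarith)]
      set σ := (t - s) ^ (1 / p) with hσ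
      have hσ0 : 0 ≤ σ := Real.rpow_nonneg (by linarith) _
      have m1 : (t - u) ^ (1 / p) ≤ σ :=
        Real.rpow_le_rpow (by linarith) (by linarith) (by positivity)
      have m2 : (u - s) ^ (1 / p) ≤ σ :=
        Real.rpow_le_rpow (by linarith) (by linarith) (by positivity)
      have m10 : 0 ≤ (t - u) ^ (1 / p) := Real.rpow_nonneg (by linarith) _
      have m20 : 0 ≤ (u - s) ^ (1 / p) := Real.rpow_nonneg (by linarith) _
      have b1 : ‖X t u‖ ≤ K₀ * σ :=
        (hX u t (by linarith) hut htT).trans (by gcongr)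
      have b2 : ‖XX t u‖ ≤ K₀ * σ ^ 2 :=
        (hXX u t (by linarith) hut htT).trans (by gcongr)
      have b3 : ‖x u - x s‖ ≤ A * σ :=
        (hinc s u h0 hsu (by linarith) (by linarith)).trans (by gcongr)
      have b4 : ‖x u - x s - eulerOne V (X u s) (x s)‖ ≤ (c + A₂) * σ ^ 2 :=
        (hcont s u h0 hsu (by linarith) (by linarith)).trans (by gcongr)
      calc _ ≤ ℓ * (K₀ * σ * (B * (A * σ) ^ 2 + B * ((c + A₂) * σ ^ 2)))
            + ℓ * (ℓ * (K₀ * σ ^ 2 * (2 * (B * B) * (A * σ)))) := by gcongr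
        _ = _ := by ring)
  obtain ⟨M, hM0, hM⟩ := exists_norm_sub_le_of_local (x := x) (T := T) (M := A) hδ hA0
    (fun s t h0 hst htT hts => (hinc s t h0 hst htT hts).trans
      (mul_le_of_le_one_right hA0 (Real.rpow_le_one (by linarith) (hts.trans hδ1)
        (by positivity))))
  have hM1 : ∀ s t, 0 ≤ s → s ≤ t → t ≤ T →
      ‖x t - x s - eulerOne V (X t s) (x s)‖ ≤ M + A₁ * T ^ (1 / p) := fun s t h0 hst htT =>
    (norm_sub_le _ _).trans (add_le_add (hM s t h0 hst htT) ((hE1 s t h0 hst htT).trans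
      (by gcongr; linarith)))
  have hM2 : ∀ s t, 0 ≤ s → s ≤ t → t ≤ T →
      ‖x t - x s - eulerOne V (X t s) (x s) - eulerTwo V (XX t s) (x s)‖
        ≤ M + A₁ * T ^ (1 / p) + A₂ * (T ^ (1 / p)) ^ 2 := fun s t h0 hst htT =>
    (norm_sub_le _ _).trans (add_le_add (hM1 s t h0 hst htT) ((hE2 s t h0 hst htT).trans (by
      have := Real.rpow_nonneg (sub_nonneg.2 hst) (1 / p)
      gcongr; linarith)))
  obtain ⟨C₁, hC₁0, hC₁⟩ := exists_le_rpow_of_local (α := 1 / p) hδ (by positivity) hM hinc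
  obtain ⟨C₂, -, hC₂⟩ := exists_le_rpow_of_local (α := 2 / p) hδ (by positivity) hM1
    (fun s t h0 hst htT hts => by
      rw [e2 _ (sub_nonneg.2 hst)]; exact hcont s t h0 hst htT hts)
  obtain ⟨C₃, hC₃0, hC₃⟩ := exists_le_rpow_of_local (α := 3 / p) hδ (by positivity) hM2 hC'
  refine ⟨⟨B * C₁, fun i s t h0 hst htT => ?_⟩, ⟨C₂, hC₂⟩, C₃, hC₃0, hC₃⟩
  refine ((hB i).2.2.1 _ _).trans ?_
  rw [mul_assoc]
  gcongr
  exact hC₁ s t h0 hst htT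

/-- **Equivalence of the differential and integral formulations of a rough differential
equation**, for a weak geometric Hölder `p`-rough path, `2 < p < 3`, and `C³_b` driving
vector fields on `ℝ^d`. -/
theorem differential_iff_integral_formulation
    (ℓ : ℕ) (T p : ℝ) (hT : 0 < T) (hp1 : 2 < p) (hp2 : p < 3)
    (Vf : Fin ℓ → EuclideanSpace ℝ (Fin d) → EuclideanSpace ℝ (Fin d))
    (hVf : ∀ i, CkbMap 3 (Vf i))
    (X : ℝ → ℝ → EuclideanSpace ℝ (Fin ℓ))
    (XX : ℝ → ℝ → EuclideanSpace ℝ (Fin ℓ × Fin ℓ))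
    (hXcont : ContinuousOn (fun q : ℝ × ℝ => X q.2 q.1)
      {q : ℝ × ℝ | 0 ≤ q.1 ∧ q.1 ≤ q.2 ∧ q.2 ≤ T})
    (hXXcont : ContinuousOn (fun q : ℝ × ℝ => XX q.2 q.1)
      {q : ℝ × ℝ | 0 ≤ q.1 ∧ q.1 ≤ q.2 ∧ q.2 ≤ T})
    (hChen : ∀ s u t : ℝ, 0 ≤ s → s ≤ u → u ≤ t → t ≤ T →
      X t s = X t u + X u s ∧
      ∀ q : Fin ℓ × Fin ℓ, XX t s q = XX t u q + XX u s q + X u s q.1 * X t u q.2)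
    (hgeom : ∀ s t : ℝ, 0 ≤ s → s ≤ t → t ≤ T → ∀ j k : Fin ℓ,
      XX t s (j, k) + XX t s (k, j) = X t s j * X t s k)
    (hhol : ∃ K : ℝ, ∀ s t : ℝ, 0 ≤ s → s ≤ t → t ≤ T →
      ‖X t s‖ ≤ K * (t - s) ^ (1 / p) ∧ ‖XX t s‖ ≤ K * (t - s) ^ (2 / p))
    (x : ℝ → EuclideanSpace ℝ (Fin d)) :
    SolvesDiff ℓ T Vf X XX x ↔ SolvesInt ℓ T p Vf X XX x := by
  obtain ⟨K, hK⟩ := hhol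
  exact ⟨fun h => h.solvesInt hp1 hp2 hVf hChen hK,
    fun h => h.solvesDiff hp1 hp2 hVf hgeom fun s t h0 hst htT => (hK s t h0 hst htT).1⟩
end
end
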